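/- Let 0 < ρ < 1/8. There exists X₀(ρ) such that for all X ≥ X₀(ρ) and every squarefree positive integer v with v ≤ X^{1/ρ}: |Σ_{n ≤ X, gcd(n,v)=1} (μ(n)/n) (log(X/n))² − (2v/φ(v)) · (log X − γ − Σ_{p | v} log p/(p−1))| ≤ (2v/φ(v)) · 0.5/log X, where γ is the Euler–Mascheroni constant and the sum over p runs over the prime divisors of v. -/

import Mathlib

open Finset

/-- First-order Taylor estimate on an interval of length one. -/
theorem norm_sub_sub_le_of_hasDerivAt {F f f' : ℝ → ℂ} {a M : ℝ}
    (hF : ∀ x ∈ Set.Icc a (a + 1), HasDerivAt F (f x) x)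
    (hf : ∀ x ∈ Set.Icc a (a + 1), HasDerivAt f (f' x) x)
    (hM : ∀ x ∈ Set.Icc a (a + 1), ‖f' x‖ ≤ M) :
    ‖F (a + 1) - F a - f a‖ ≤ M := by
  have ha : a ∈ Set.Icc a (a + 1) := ⟨le_rfl, by linarith⟩
  have ha1 : a + 1 ∈ Set.Icc a (a + 1) := ⟨by linarith, le_rfl⟩
  have hM0 : 0 ≤ M := (norm_nonneg _).trans (hM a ha)
  have hconv : Convex ℝ (Set.Icc a (a + 1)) := convex_Icc _ _
  have h1 : ∀ x ∈ Set.Icc a (a + 1), ‖f x - f a‖ ≤ M := by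
    intro x hx
    refine (hconv.norm_image_sub_le_of_norm_hasDerivWithin_le
      (fun y hy => (hf y hy).hasDerivWithinAt) hM ha hx).trans ?_
    rw [Real.norm_of_nonneg (by linarith [hx.1])]
    exact mul_le_of_le_one_right hM0 (by linarith [hx.2])
  have h2 := hconv.norm_image_sub_le_of_norm_hasDerivWithin_le
    (f := fun x : ℝ => F x - x * f a) (f' := fun x => f x - f a) (fun y hy =>
      ((hF y hy).sub (by simpa using (Complex.ofRealCLM.hasDerivAt (x := y)).mul_const (f a))
        ).hasDerivWithinAt) h1 ha ha1
  simp only [add_sub_cancel_left, norm_one, mul_one] at h2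
  convert! h2 using 2
  push_cast
  ring

/-- Comparison of a series with an integral whose primitive vanishes at infinity. -/
theorem norm_tsum_le_of_hasDerivAt {F f f' : ℝ → ℂ} {N : ℕ} {K : ℝ}
    (hF : ∀ x : ℝ, N ≤ x → HasDerivAt F (f x) x)
    (hf : ∀ x : ℝ, N ≤ x → HasDerivAt f (f' x) x)
    (hN : 0 < N) (hK : ∀ x : ℝ, N ≤ x → ‖f' x‖ ≤ K * x ^ (-(3 / 2) : ℝ))
    (hF0 : Filter.Tendsto (fun n : ℕ => F n) Filter.atTop (nhds 0))
    (hsum : Summable fun n : ℕ => f n) :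
    ‖∑' n : ℕ, f n‖ ≤ ∑ n ∈ range N, ‖f n‖ + ‖F N‖ +
      K * ∑' n : ℕ, (n : ℝ) ^ (-(3 / 2) : ℝ) := by
  have hK0 : 0 ≤ K := by
    have h := (norm_nonneg _).trans (hK N le_rfl)
    have hN' : (0 : ℝ) < N := by exact_mod_cast hN
    exact nonneg_of_mul_nonneg_left h (by positivity)
  have hZ : Summable fun n : ℕ => (n : ℝ) ^ (-(3 / 2) : ℝ) :=
    Real.summable_nat_rpow.2 (by norm_num)
  have hstep : ∀ n : ℕ, N ≤ n →
      ‖F (n + 1 : ℕ) - F n - f n‖ ≤ K * (n : ℝ) ^ (-(3 / 2) : ℝ) := by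
    intro n hn
    have hn' : (N : ℝ) ≤ n := by exact_mod_cast hn
    have hn0 : (0 : ℝ) < n := by exact_mod_cast hN.trans_le hn
    push_cast
    refine norm_sub_sub_le_of_hasDerivAt (f' := f') (fun x hx => hF x (hn'.trans hx.1))
      (fun x hx => hf x (hn'.trans hx.1)) fun x hx => (hK x (hn'.trans hx.1)).trans ?_
    exact mul_le_mul_of_nonneg_left
      (Real.rpow_le_rpow_of_nonpos hn0 hx.1 (by norm_num)) hK0
  have hpart : ∀ M : ℕ, N ≤ M → ‖∑ n ∈ range M, f n‖ ≤ ∑ n ∈ range N, ‖f n‖ + ‖F N‖ +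
      K * ∑' n : ℕ, (n : ℝ) ^ (-(3 / 2) : ℝ) + ‖F M‖ := by
    intro M hM
    have e : ∑ n ∈ range M, f n = ∑ n ∈ range N, f n + (F M - F N) -
        ∑ n ∈ Ico N M, (F (n + 1 : ℕ) - F n - f n) := by
      rw [Finset.sum_sub_distrib, Finset.sum_Ico_sub (fun n : ℕ => F n) hM,
        ← Finset.sum_range_add_sum_Ico _ hM]
      ring
    have h3 : ‖∑ n ∈ Ico N M, (F (n + 1 : ℕ) - F n - f n)‖ ≤
        K * ∑' n : ℕ, (n : ℝ) ^ (-(3 / 2) : ℝ) := by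
      refine (norm_sum_le_of_le _ fun n hn => hstep n (mem_Ico.1 hn).1).trans ?_
      rw [← Finset.mul_sum]
      exact mul_le_mul_of_nonneg_left
        (hZ.sum_le_tsum _ fun n _ => by positivity) hK0
    rw [e]
    have h4 := norm_sum_le (range N) (fun n : ℕ => f n)
    have h5 := norm_sub_le (∑ n ∈ range N, f n + (F M - F N))
      (∑ n ∈ Ico N M, (F (n + 1 : ℕ) - F n - f n))
    have h6 := norm_add_le (∑ n ∈ range N, f n) (F M - F N)
    have h7 := norm_sub_le (F M) (F N)
    linarith
  have hlim := hF0.norm.const_add (∑ n ∈ range N, ‖f n‖ + ‖F N‖ +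
      K * ∑' n : ℕ, (n : ℝ) ^ (-(3 / 2) : ℝ))
  rw [norm_zero, add_zero] at hlim
  exact le_of_tendsto_of_tendsto hsum.hasSum.tendsto_sum_nat.norm hlim
    (Filter.eventually_atTop.2 ⟨N, hpart⟩)

theorem sum_range_one_div_le (N : ℕ) (hN : 0 < N) :
    ∑ n ∈ range N, 1 / (n : ℝ) ≤ 1 + Real.log N := by
  have h := harmonic_le_one_add_log N
  rw [harmonic] at h
  push_cast at h
  refine le_trans ?_ h
  obtain ⟨M, rfl⟩ : ∃ M, N = M + 1 := ⟨N - 1, by omega⟩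
  rw [Finset.sum_range_succ', Finset.sum_range_succ]
  simp
  positivity

section ZetaBound

variable {s : ℂ}

theorem hasDerivAt_ofReal_cpow {x : ℝ} (hx : 0 < x) (r : ℂ) :
    HasDerivAt (fun y : ℝ => (y : ℂ) ^ r) (r * (x : ℂ) ^ (r - 1)) x := by
  have := (hasDerivAt_id (x : ℂ)).cpow_const (c := r) (Or.inl (by simpa using hx))
  simpa using this.comp_ofReal

theorem norm_riemannZeta_le (hs : 1 < s.re) (ht : s.im ≠ 0) {N : ℕ} (hN : 0 < N) :
    ‖riemannZeta s‖ ≤ 1 + Real.log N + 1 / |s.im| +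
      ‖s‖ * (N : ℝ) ^ (-(1 / 4) : ℝ) * ∑' n : ℕ, (n : ℝ) ^ (-(3 / 2) : ℝ) := by
  have hN' : (1 : ℝ) ≤ N := by exact_mod_cast hN
  have hs1 : s ≠ 1 := fun h => by simp [h] at hs
  have h1s : (1 - s) ≠ 0 := sub_ne_zero.2 hs1.symm
  have him : |s.im| ≤ ‖1 - s‖ := by
    simpa using Complex.abs_im_le_norm (1 - s)
  have hs0 : s ≠ 0 := fun h => by simp [h] at hs; linarith
  have hpos : ∀ x : ℝ, (N : ℝ) ≤ x → 0 < x := fun x hx => by linarith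
  have hzeta : riemannZeta s = ∑' n : ℕ, ((n : ℝ) : ℂ) ^ (-s) := by
    rw [zeta_eq_tsum_one_div_nat_cpow hs]
    simp [Complex.cpow_neg]
  rw [hzeta]
  refine (norm_tsum_le_of_hasDerivAt (F := fun x => (x : ℂ) ^ (1 - s) / (1 - s))
    (f := fun x => (x : ℂ) ^ (-s)) (f' := fun x => -s * (x : ℂ) ^ (-s - 1)) (N := N)
    (K := ‖s‖ * (N : ℝ) ^ (-(1 / 4) : ℝ)) ?_ ?_ hN ?_ ?_ ?_).trans ?_
  · intro x hx
    have := (hasDerivAt_ofReal_cpow (hpos x hx) (1 - s)).div_const (1 - s)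
    rw [mul_div_cancel_left₀ _ h1s] at this
    simpa using this
  · intro x hx
    exact hasDerivAt_ofReal_cpow (hpos x hx) (-s)
  · intro x hx
    have hx0 := hpos x hx
    rw [norm_mul, norm_neg, Complex.norm_cpow_eq_rpow_re_of_pos hx0, mul_assoc]
    gcongr
    calc x ^ (-s - 1).re ≤ x ^ (-(1 / 4) + -(3 / 2) : ℝ) := by
          apply Real.rpow_le_rpow_of_exponent_le (by linarith)
          simp; linarith
      _ ≤ _ := by
          rw [Real.rpow_add hx0]
          gcongr ?_ * _
          exact Real.rpow_le_rpow_of_nonpos (by linarith) hx (by norm_num)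
  · rw [tendsto_zero_iff_norm_tendsto_zero]
    have h := ((tendsto_rpow_neg_atTop (y := s.re - 1) (by linarith)).comp
      (tendsto_natCast_atTop_atTop (R := ℝ))).div_const ‖1 - s‖
    rw [zero_div] at h
    refine h.congr' ?_
    filter_upwards [Filter.eventually_gt_atTop 0] with n hn
    rw [norm_div, Complex.norm_cpow_eq_rpow_re_of_pos (by exact_mod_cast hn)]
    simp
  · refine (Complex.summable_one_div_nat_cpow.2 hs).congr fun n => ?_
    simp [Complex.cpow_neg]
  · gcongr ?_ + ?_ + _
    · refine le_trans (Finset.sum_le_sum fun n _ => ?_) (sum_range_one_div_le N hN)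
      rcases Nat.eq_zero_or_pos n with rfl | hn
      · simp [Complex.zero_cpow (neg_ne_zero.2 hs0)]
      · rw [Complex.norm_cpow_eq_rpow_re_of_pos (by exact_mod_cast hn), one_div,
          ← Real.rpow_neg_one]
        apply Real.rpow_le_rpow_of_exponent_le (by exact_mod_cast hn)
        simp; linarith
    · rw [norm_div, Complex.norm_cpow_eq_rpow_re_of_pos (by linarith)]
      refine div_le_div₀ zero_le_one ?_ (abs_pos.2 ht) him
      exact Real.rpow_le_one_of_one_le_of_nonpos hN' (by simp; linarith)

theorem norm_deriv_riemannZeta_le (hs : 1 < s.re) (ht : s.im ≠ 0) {N : ℕ} (hN : 0 < N) :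
    ‖deriv riemannZeta s‖ ≤ Real.log N * (1 + Real.log N) +
      (Real.log N / |s.im| + 1 / |s.im| ^ 2) +
      5 * (1 + ‖s‖) * (N : ℝ) ^ (-(1 / 4) : ℝ) * ∑' n : ℕ, (n : ℝ) ^ (-(3 / 2) : ℝ) := by
  have hN' : (1 : ℝ) ≤ N := by exact_mod_cast hN
  have hs1 : s ≠ 1 := fun h => by simp [h] at hs
  have h1s : (1 - s) ≠ 0 := sub_ne_zero.2 hs1.symm
  have him : |s.im| ≤ ‖1 - s‖ := by
    simpa using Complex.abs_im_le_norm (1 - s)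
  have hs0 : s ≠ 0 := fun h => by simp [h] at hs; linarith
  have hpos : ∀ x : ℝ, (N : ℝ) ≤ x → 0 < x := fun x hx => by linarith
  have habs : LSeries.abscissaOfAbsConv (1 : ℕ → ℂ) < s.re := by
    rw [LSeries.abscissaOfAbsConv_one]; exact_mod_cast hs
  have hev : riemannZeta =ᶠ[nhds s] LSeries 1 := by
    filter_upwards [(isOpen_lt continuous_const Complex.continuous_re).mem_nhds hs] with z hz
    exact (LSeries_one_eq_riemannZeta hz).symm
  have hcongr : ∀ n : ℕ, LSeries.term (LSeries.logMul 1) s n =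
      (Real.log n : ℂ) * ((n : ℝ) : ℂ) ^ (-s) := by
    intro n
    rcases Nat.eq_zero_or_pos n with rfl | hn
    · simp
    · rw [LSeries.term_of_ne_zero hn.ne', LSeries.logMul, Complex.cpow_neg]
      simp [div_eq_mul_inv]
  have hzeta : deriv riemannZeta s = -∑' n : ℕ, (Real.log n : ℂ) * ((n : ℝ) : ℂ) ^ (-s) := by
    rw [hev.deriv_eq, LSeries_deriv habs, LSeries]
    simp_rw [hcongr]
  have hlogd : ∀ x : ℝ, 0 < x → HasDerivAt (fun y : ℝ => (Real.log y : ℂ)) ((x : ℂ)⁻¹) x := by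
    intro x hx
    simpa using (Real.hasDerivAt_log hx.ne').ofReal_comp
  rw [hzeta, norm_neg]
  refine (norm_tsum_le_of_hasDerivAt
    (F := fun x => (Real.log x : ℂ) * ((x : ℂ) ^ (1 - s) / (1 - s)) -
      (x : ℂ) ^ (1 - s) / (1 - s) ^ 2)
    (f := fun x => (Real.log x : ℂ) * (x : ℂ) ^ (-s))
    (f' := fun x => (1 - s * (Real.log x : ℂ)) * (x : ℂ) ^ (-s - 1)) (N := N)
    (K := 5 * (1 + ‖s‖) * (N : ℝ) ^ (-(1 / 4) : ℝ)) ?_ ?_ hN ?_ ?_ ?_).trans ?_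
  · intro x hx
    have hx0 := hpos x hx
    have hx0' : (x : ℂ) ≠ 0 := by exact_mod_cast hx0.ne'
    have hd := hasDerivAt_ofReal_cpow hx0 (1 - s)
    refine (((hlogd x hx0).mul (hd.div_const (1 - s))).sub
      (hd.div_const ((1 - s) ^ 2))).congr_deriv ?_
    have e : (x : ℂ) ^ (1 - s) = x * (x : ℂ) ^ (-s) := by
      rw [sub_eq_add_neg, Complex.cpow_add _ _ hx0', Complex.cpow_one]
    rw [show (1 - s - 1) = -s by ring, e]
    field_simp
    ring
  · intro x hx
    have hx0 := hpos x hx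
    have hx0' : (x : ℂ) ≠ 0 := by exact_mod_cast hx0.ne'
    refine ((hlogd x hx0).mul (hasDerivAt_ofReal_cpow hx0 (-s))).congr_deriv ?_
    rw [Complex.cpow_sub _ _ hx0', Complex.cpow_one]
    field_simp
    ring
  · intro x hx
    have hx0 := hpos x hx
    have hx1 : 1 ≤ x := hN'.trans hx
    have hlog0 : 0 ≤ Real.log x := Real.log_nonneg hx1
    rw [norm_mul, Complex.norm_cpow_eq_rpow_re_of_pos hx0]
    have h1 : ‖1 - s * (Real.log x : ℂ)‖ ≤ 5 * (1 + ‖s‖) * x ^ (1 / 4 : ℝ) := by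
      have hl : Real.log x ≤ 4 * x ^ (1 / 4 : ℝ) := by
        have := Real.log_le_rpow_div hx0.le (ε := 1 / 4) (by norm_num)
        linarith
      have h1x : 1 ≤ x ^ (1 / 4 : ℝ) := Real.one_le_rpow hx1 (by norm_num)
      calc ‖1 - s * (Real.log x : ℂ)‖ ≤ 1 + ‖s‖ * Real.log x := by
            refine (norm_sub_le _ _).trans ?_
            rw [norm_one, norm_mul, Complex.norm_real, Real.norm_of_nonneg hlog0]
        _ ≤ 5 * x ^ (1 / 4 : ℝ) + ‖s‖ * (5 * x ^ (1 / 4 : ℝ)) := by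
            gcongr <;> linarith
        _ = _ := by ring
    have h2 : x ^ (-s - 1).re ≤ x ^ (-(1 / 4) + (-(1 / 4) + -(3 / 2)) : ℝ) := by
      apply Real.rpow_le_rpow_of_exponent_le hx1
      simp; linarith
    calc ‖1 - s * (Real.log x : ℂ)‖ * x ^ (-s - 1).re
        ≤ 5 * (1 + ‖s‖) * x ^ (1 / 4 : ℝ) * x ^ (-(1 / 4) + (-(1 / 4) + -(3 / 2)) : ℝ) := by
          gcongr
      _ = 5 * (1 + ‖s‖) * x ^ (-(1 / 4) : ℝ) * x ^ (-(3 / 2) : ℝ) := by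
          rw [mul_assoc (5 * (1 + ‖s‖)), ← Real.rpow_add hx0, mul_assoc (5 * (1 + ‖s‖)),
            ← Real.rpow_add hx0]
          norm_num
      _ ≤ _ := by
          gcongr ?_ * _
          gcongr ?_ * ?_
          exact Real.rpow_le_rpow_of_nonpos (by linarith) hx (by norm_num)
  · rw [tendsto_zero_iff_norm_tendsto_zero]
    have h1 := ((tendsto_rpow_neg_atTop (y := s.re - 1) (by linarith)).comp
      (tendsto_natCast_atTop_atTop (R := ℝ))).div_const ‖(1 - s) ^ 2‖
    have h2 := ((isLittleO_log_rpow_atTop (r := s.re - 1) (by linarith)).tendsto_div_nhds_zero.comp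
      (tendsto_natCast_atTop_atTop (R := ℝ))).div_const ‖1 - s‖
    have h := h2.add h1
    rw [zero_div, zero_div, add_zero] at h
    refine squeeze_zero' (Filter.Eventually.of_forall fun _ => norm_nonneg _) ?_ h
    filter_upwards [Filter.eventually_gt_atTop 0] with n hn
    have hn0 : (0 : ℝ) < n := by exact_mod_cast hn
    have hn1 : (1 : ℝ) ≤ n := by exact_mod_cast hn
    refine (norm_sub_le _ _).trans (le_of_eq ?_)
    rw [norm_mul, norm_div, norm_div, Complex.norm_cpow_eq_rpow_re_of_pos hn0,
      Complex.norm_real, Real.norm_of_nonneg (Real.log_nonneg hn1)]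
    have e : (n : ℝ) ^ (1 - s).re = ((n : ℝ) ^ (s.re - 1))⁻¹ := by
      rw [← Real.rpow_neg hn0.le]; simp
    simp only [Function.comp, e, Real.rpow_neg hn0.le]
    ring
  · refine (LSeriesSummable_logMul_of_lt_re habs).congr fun n => ?_
    exact hcongr n
  · have hlogN : 0 ≤ Real.log N := Real.log_nonneg hN'
    gcongr ?_ + ?_ + _
    · refine le_trans (Finset.sum_le_sum (g := fun n : ℕ => Real.log N * (1 / n)) fun n hn => ?_) ?_
      · rcases Nat.eq_zero_or_pos n with rfl | hn0
        · simp
        · have hn1 : (1 : ℝ) ≤ n := by exact_mod_cast hn0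
          have hnN : (n : ℝ) ≤ N := by exact_mod_cast (mem_range.1 hn).le
          rw [norm_mul, Complex.norm_cpow_eq_rpow_re_of_pos (by linarith), Complex.norm_real,
            Real.norm_of_nonneg (Real.log_nonneg hn1), one_div, ← Real.rpow_neg_one]
          gcongr
          simp; linarith
      · rw [← Finset.mul_sum]
        gcongr
        exact sum_range_one_div_le N hN
    · have hle : (N : ℝ) ^ (1 - s).re ≤ 1 :=
        Real.rpow_le_one_of_one_le_of_nonpos hN' (by simp; linarith)
      have him0 : 0 < |s.im| := abs_pos.2 ht
      refine (norm_sub_le _ _).trans ?_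
      rw [norm_mul, norm_div, norm_div, norm_pow, Complex.norm_real, Real.norm_of_nonneg hlogN,
        Complex.norm_cpow_eq_rpow_re_of_pos (by linarith), ← mul_div_assoc]
      gcongr
      · exact mul_le_of_le_one_right hlogN hle

end ZetaBound

/-- Slow growth of `ζ` and its derivative to the right of the line `re s = 1`. -/
theorem exists_norm_riemannZeta_le_rpow : ∃ C : ℝ, 1 ≤ C ∧ ∀ s : ℂ, 1 < s.re → s.re ≤ 2 →
    1 ≤ |s.im| → ‖riemannZeta s‖ ≤ C * |s.im| ^ (1 / 9 : ℝ) ∧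
      ‖deriv riemannZeta s‖ ≤ C * |s.im| ^ (1 / 9 : ℝ) := by
  set Z := ∑' n : ℕ, (n : ℝ) ^ (-(3 / 2) : ℝ)
  have hZ : 0 ≤ Z := tsum_nonneg fun n => by positivity
  refine ⟨74 * 75 + 75 + 20 * Z, by linarith, fun s hs hs2 ht => ?_⟩
  set t := |s.im| with ht'
  have ht0 : 0 < t := by linarith
  have him : s.im ≠ 0 := abs_pos.1 ht0
  set w := t ^ (1 / 18 : ℝ) with hw
  have hw1 : 1 ≤ w := Real.one_le_rpow ht (by norm_num)
  have hww : t ^ (1 / 9 : ℝ) = w * w := by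
    rw [hw, ← Real.rpow_add ht0]; norm_num
  set N := ⌈t ^ 4⌉₊ with hN
  have ht4 : (1 : ℝ) ≤ t ^ 4 := one_le_pow₀ ht
  have hN0 : 0 < N := Nat.ceil_pos.2 (by linarith)
  have hNge : t ^ 4 ≤ N := Nat.le_ceil _
  have hNle : (N : ℝ) ≤ 2 * t ^ 4 := by
    have := Nat.ceil_lt_add_one (a := t ^ 4) (by linarith)
    linarith
  have hN1 : (1 : ℝ) ≤ N := ht4.trans hNge
  have hlogN0 : 0 ≤ Real.log N := Real.log_nonneg hN1
  have hlogN : Real.log N ≤ 73 * w := by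
    have h1 : Real.log N ≤ Real.log 2 + 4 * Real.log t := by
      have := Real.log_le_log (by linarith) hNle
      rw [Real.log_mul (by norm_num) (by positivity), Real.log_pow] at this
      exact_mod_cast this
    have h2 : Real.log t ≤ 18 * w := by
      have := Real.log_le_rpow_div ht0.le (ε := 1 / 18) (by norm_num)
      linarith
    have h3 := Real.log_two_lt_d9
    linarith
  have hsn : 1 + ‖s‖ ≤ 4 * t := by
    have := Complex.norm_le_abs_re_add_abs_im s
    rw [abs_of_pos (by linarith : 0 < s.re)] at this
    linarith
  have hNq : (N : ℝ) ^ (-(1 / 4) : ℝ) ≤ t⁻¹ := by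
    have := Real.rpow_le_rpow_of_nonpos (by positivity) hNge (z := -(1 / 4)) (by norm_num)
    rwa [← Real.rpow_natCast, ← Real.rpow_mul ht0.le,
      show (((4 : ℕ) : ℝ) * -(1 / 4)) = -1 by norm_num, Real.rpow_neg_one] at this
  have hprod : (1 + ‖s‖) * (N : ℝ) ^ (-(1 / 4) : ℝ) ≤ 4 := by
    calc (1 + ‖s‖) * (N : ℝ) ^ (-(1 / 4) : ℝ) ≤ (4 * t) * t⁻¹ := by gcongr
      _ = 4 := by field_simp
  have hprod' : ‖s‖ * (N : ℝ) ^ (-(1 / 4) : ℝ) ≤ 4 := by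
    refine le_trans ?_ hprod
    gcongr
    linarith
  have h1t : 1 / t ≤ 1 := (div_le_one ht0).2 ht
  have hlt : Real.log N / t ≤ Real.log N := div_le_self hlogN0 ht
  have h1t2 : 1 / t ^ 2 ≤ 1 := (div_le_one (by positivity)).2 (one_le_pow₀ ht)
  have hww1 : w ≤ w * w := le_mul_of_one_le_left (by linarith) hw1
  have hZw : Z ≤ Z * (w * w) := le_mul_of_one_le_right hZ (by linarith)
  have hlog2 : Real.log N * (1 + Real.log N) ≤ 73 * w * (74 * w) := by
    gcongr
    linarith
  have hb1 := norm_riemannZeta_le hs him hN0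
  have hb2 := norm_deriv_riemannZeta_le hs him hN0
  have hc1 : ‖s‖ * (N : ℝ) ^ (-(1 / 4) : ℝ) * Z ≤ 4 * Z := by gcongr
  have hc2 : 5 * (1 + ‖s‖) * (N : ℝ) ^ (-(1 / 4) : ℝ) * Z ≤ 20 * Z := by
    have : 5 * (1 + ‖s‖) * (N : ℝ) ^ (-(1 / 4) : ℝ) ≤ 20 := by linarith
    gcongr
  rw [hww]
  constructor
  · linarith
  · linarith

theorem norm_riemannZeta_product_ge_one {x : ℝ} (hx : 0 < x) (y : ℝ) :
    1 ≤ ‖riemannZeta (1 + x)‖ ^ 3 * ‖riemannZeta (1 + x + Complex.I * y)‖ ^ 4 *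
      ‖riemannZeta (1 + x + 2 * Complex.I * y)‖ := by
  have h := DirichletCharacter.norm_LFunction_product_ge_one (1 : DirichletCharacter ℂ 1) hx y
  simpa [DirichletCharacter.LFunctionTrivChar, DirichletCharacter.LFunction_modOne_eq] using h

theorem exists_norm_riemannZeta_one_add_le : ∃ C : ℝ, 1 ≤ C ∧ ∀ x : ℝ, 0 < x → x ≤ 1 →
    ‖riemannZeta (1 + x)‖ ≤ C / x := by
  have hc : ContinuousOn (fun x : ℝ => riemannZeta₁ (1 + x)) (Set.Icc 0 1) := by
    have := differentiable_riemannZeta₁.continuous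
    fun_prop
  obtain ⟨C, hC⟩ := isCompact_Icc.exists_bound_of_continuousOn hc
  refine ⟨max C 1, le_max_right _ _, fun x hx hx1 => ?_⟩
  have hne : (1 + x : ℂ) ≠ 1 := by simpa using hx.ne'
  rw [riemannZeta_eq_inv_sub_mul hne, norm_mul, add_sub_cancel_left, norm_inv, Complex.norm_real,
    Real.norm_of_nonneg hx.le, div_eq_inv_mul]
  gcongr
  exact (hC x ⟨hx.le, hx1⟩).trans (le_max_left _ _)

/-- A lower bound for `ζ` to the right of the line `re s = 1`. -/
theorem exists_le_norm_riemannZeta : ∃ c : ℝ, 0 < c ∧ ∀ s : ℂ, 1 < s.re → s.re ≤ 2 →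
    1 ≤ |s.im| → c ≤ ‖riemannZeta s‖ * |s.im| ^ (4 / 9 : ℝ) := by
  obtain ⟨C₁, hC₁, hgrow⟩ := exists_norm_riemannZeta_le_rpow
  obtain ⟨C₂, hC₂, hpole⟩ := exists_norm_riemannZeta_one_add_le
  set C := max C₁ C₂
  have hC : 1 ≤ C := hC₁.trans (le_max_left _ _)
  refine ⟨1 / (32 * C ^ 7), by positivity, fun s hs hs2 ht => ?_⟩
  set t := s.im with ht'
  set L := |t| ^ (1 / 9 : ℝ) with hL
  have ht0 : 0 < |t| := by linarith
  have hL1 : 1 ≤ L := Real.one_le_rpow ht (by norm_num)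
  have hL4 : |t| ^ (4 / 9 : ℝ) = L ^ 4 := by
    rw [hL, ← Real.rpow_natCast, ← Real.rpow_mul ht0.le]; norm_num
  have hlow : ∀ x : ℝ, 0 < x → x ≤ 1 →
      x ^ 3 / (2 * C ^ 4 * L) ≤ ‖riemannZeta (1 + x + Complex.I * t)‖ ^ 4 := by
    intro x hx hx1
    have h1 := norm_riemannZeta_product_ge_one hx t
    have h2 : ‖riemannZeta (1 + x)‖ ≤ C / x := (hpole x hx hx1).trans (by
      gcongr; exact le_max_right _ _)
    have h3 : ‖riemannZeta (1 + x + 2 * Complex.I * t)‖ ≤ 2 * C * L := by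
      have := (hgrow (1 + x + 2 * Complex.I * t) (by simpa using hx) (by simp; linarith)
        (by simp [abs_mul]; linarith)).1
      have e : (1 + x + 2 * Complex.I * t : ℂ).im = 2 * t := by simp
      rw [e, abs_mul, Real.mul_rpow (by norm_num) ht0.le, abs_of_pos (by norm_num : (0 : ℝ) < 2),
        ← hL] at this
      refine this.trans ?_
      have h29 : (2 : ℝ) ^ (1 / 9 : ℝ) ≤ 2 := by
        simpa using Real.rpow_le_rpow_of_exponent_le (x := 2) (by norm_num)
          (by norm_num : (1 / 9 : ℝ) ≤ 1)
      calc C₁ * (2 ^ (1 / 9 : ℝ) * L) ≤ C * (2 * L) := by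
            gcongr; exact le_max_left _ _
        _ = _ := by ring
    have h4 : 1 ≤ (C / x) ^ 3 * ‖riemannZeta (1 + x + Complex.I * t)‖ ^ 4 * (2 * C * L) := by
      refine h1.trans ?_
      gcongr
    rw [div_le_iff₀ (by positivity)]
    calc x ^ 3 = x ^ 3 * 1 := by ring
      _ ≤ x ^ 3 * ((C / x) ^ 3 * ‖riemannZeta (1 + x + Complex.I * t)‖ ^ 4 * (2 * C * L)) := by
          gcongr
      _ = _ := by field_simp
  set η := 1 / (32 * C ^ 8 * L ^ 5) with hη
  have hη0 : 0 < η := by positivity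
  have hη1 : η ≤ 1 := by
    rw [hη, div_le_one (by positivity)]
    have h1 : 1 ≤ C ^ 8 := one_le_pow₀ hC
    have h2 : 1 ≤ L ^ 5 := one_le_pow₀ hL1
    nlinarith [one_le_mul_of_one_le_of_one_le h1 h2]
  have hge : ∀ x : ℝ, η ≤ x → x ≤ 1 →
      2 * (C * L * η) ≤ ‖riemannZeta (1 + x + Complex.I * t)‖ := by
    intro x hx hx1
    have h := hlow x (hη0.trans_le hx) hx1
    refine le_of_pow_le_pow_left₀ (n := 4) (by norm_num) (norm_nonneg _) (le_trans ?_ h)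
    calc (2 * (C * L * η)) ^ 4 = η ^ 3 / (2 * C ^ 4 * L) := by
          rw [hη]; field_simp; norm_num
      _ ≤ _ := by gcongr
  have hmain : C * L * η ≤ ‖riemannZeta s‖ := by
    have hs' : s = 1 + ((s.re - 1 : ℝ) : ℂ) + Complex.I * t := by
      apply Complex.ext <;> simp [ht']
    have hCLη : 0 ≤ C * L * η := by positivity
    rcases le_total η (s.re - 1) with hx | hx
    · have := hge _ hx (by linarith)
      rw [← hs'] at this
      linarith
    · have h1 := hge η le_rfl hη1
      set s' : ℂ := 1 + (η : ℂ) + Complex.I * t with hs1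
      have hre : s'.re = 1 + η := by simp [hs1]
      have him : s'.im = t := by simp [hs1]
      set S : Set ℂ := {z | 1 < z.re ∧ z.re ≤ 2 ∧ z.im = t} with hS
      have hconv : Convex ℝ S := by
        have e : S = (Complex.reLm ⁻¹' Set.Ioc 1 2) ∩ (Complex.imLm ⁻¹' {t}) := by
          ext z; simp [hS, and_assoc]
        rw [e]
        exact ((convex_Ioc 1 2).linear_preimage _).inter ((convex_singleton t).linear_preimage _)
      have hder : ∀ z ∈ S, ‖deriv riemannZeta z‖ ≤ C * L := by
        intro z hz
        have := (hgrow z hz.1 hz.2.1 (by rw [hz.2.2]; exact ht)).2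
        rw [hz.2.2] at this
        refine this.trans ?_
        gcongr; exact le_max_left _ _
      have hmv := hconv.norm_image_sub_le_of_norm_deriv_le (𝕜 := ℂ) (f := riemannZeta)
        (fun z hz => differentiableAt_riemannZeta (fun h => by
          have := hz.1; rw [h] at this; simp at this)) hder
        (x := s) (y := s') ⟨hs, hs2, rfl⟩ ⟨by linarith, by linarith, him⟩
      have hdist : ‖s' - s‖ ≤ η := by
        have e : s' - s = ((1 + η - s.re : ℝ) : ℂ) := by
          apply Complex.ext <;> simp [hs1, ht']
        rw [e, Complex.norm_real, Real.norm_of_nonneg (by linarith)]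
        linarith
      have h2 : ‖riemannZeta s' - riemannZeta s‖ ≤ C * L * η := hmv.trans (by gcongr)
      have h3 := norm_sub_norm_le (riemannZeta s') (riemannZeta s)
      linarith
  rw [hL4]
  calc 1 / (32 * C ^ 7) = C * L * η * L ^ 4 := by rw [hη]; field_simp
    _ ≤ _ := by gcongr

/-- The sum `∑ μ(n) / n * log² (X / n)` over `n ≤ X` divisible by no element of `P`. -/
noncomputable def moebiusLogSqSum (P : Finset ℕ) (X : ℝ) : ℝ :=
  ∑ n ∈ (Icc 1 ⌊X⌋₊).filter (fun n => ∀ p ∈ P, ¬ p ∣ n),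
    ((ArithmeticFunction.moebius n : ℤ) : ℝ) / n * Real.log (X / n) ^ 2

/-- The density `∏_{p ∈ P} (1 - 1 / p)⁻¹`. -/
noncomputable def eulerWeight (P : Finset ℕ) : ℝ := ∏ p ∈ P, (1 - 1 / (p : ℝ))⁻¹

/-- The main term in the asymptotic expansion of `moebiusLogSqSum P X`. -/
noncomputable def moebiusLogSqMain (P : Finset ℕ) (X : ℝ) : ℝ :=
  2 * eulerWeight P * (Real.log X - Real.eulerMascheroniConstant -
    ∑ p ∈ P, Real.log p / ((p : ℝ) - 1))

theorem moebiusLogSqSum_of_lt_one (P : Finset ℕ) {X : ℝ} (hX : X < 1) :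
    moebiusLogSqSum P X = 0 := by
  have : ⌊X⌋₊ = 0 := Nat.floor_eq_zero.2 hX
  simp [moebiusLogSqSum, this]

theorem moebiusLogSqSum_insert {P : Finset ℕ} {p : ℕ} (hp : p.Prime)
    (hP : ∀ q ∈ P, q.Prime) (hpP : p ∉ P) {X : ℝ} (hX : 0 < X) :
    moebiusLogSqSum (insert p P) X =
      moebiusLogSqSum P X + 1 / p * moebiusLogSqSum (insert p P) (X / p) := by
  have hp0 : (p : ℝ) ≠ 0 := by exact_mod_cast hp.ne_zero
  have hsplit := Finset.sum_filter_add_sum_filter_not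
    ((Icc 1 ⌊X⌋₊).filter (fun n => ∀ q ∈ P, ¬ q ∣ n)) (fun n => ¬ p ∣ n)
    (fun n => ((ArithmeticFunction.moebius n : ℤ) : ℝ) / n * Real.log (X / n) ^ 2)
  have hfirst : ((Icc 1 ⌊X⌋₊).filter (fun n => ∀ q ∈ P, ¬ q ∣ n)).filter (fun n => ¬ p ∣ n) =
      (Icc 1 ⌊X⌋₊).filter (fun n => ∀ q ∈ insert p P, ¬ q ∣ n) := by
    ext n; simp; tauto
  have hsecond : ∑ n ∈ ((Icc 1 ⌊X⌋₊).filter (fun n => ∀ q ∈ P, ¬ q ∣ n)).filter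
        (fun n => ¬ ¬ p ∣ n),
        ((ArithmeticFunction.moebius n : ℤ) : ℝ) / n * Real.log (X / n) ^ 2 =
      - (1 / p * moebiusLogSqSum (insert p P) (X / p)) := by
    rw [moebiusLogSqSum, Finset.mul_sum, ← Finset.sum_neg_distrib]
    symm
    apply Finset.sum_of_injOn (fun m => p * m)
    · intro a _ b _ h
      exact Nat.eq_of_mul_eq_mul_left hp.pos h
    · intro m hm
      simp only [coe_filter, Set.mem_ofPred_eq, mem_Icc, mem_insert, forall_eq_or_imp] at hm ⊢
      obtain ⟨⟨h1, h2⟩, h3, h4⟩ := hm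
      simp only [mem_filter, mem_Icc]
      refine ⟨⟨⟨Nat.mul_pos hp.pos h1, ?_⟩, fun q hq hdvd => ?_⟩, by simp⟩
      · rw [Nat.le_floor_iff (by positivity)] at h2 ⊢
        rw [le_div_iff₀ (by exact_mod_cast hp.pos)] at h2
        push_cast; linarith
      · rcases (hP q hq).dvd_mul.1 hdvd with h | h
        · rw [Nat.prime_dvd_prime_iff_eq (hP q hq) hp] at h
          exact hpP (h ▸ hq)
        · exact h4 q hq h
    · intro n hn hn'
      simp only [mem_filter, mem_Icc, not_not] at hn
      obtain ⟨⟨⟨h1, h2⟩, h3⟩, m, rfl⟩ := hn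
      have hm : p ∣ m := by
        by_contra hm
        apply hn'
        refine ⟨m, ?_, rfl⟩
        simp only [coe_filter, Set.mem_ofPred_eq, mem_Icc, mem_insert, forall_eq_or_imp]
        refine ⟨⟨Nat.pos_of_ne_zero (by rintro rfl; simp at h1), ?_⟩, hm,
          fun q hq h => h3 q hq (h.mul_left p)⟩
        rw [Nat.le_floor_iff (by positivity)] at h2 ⊢
        rw [le_div_iff₀ (by exact_mod_cast hp.pos)]
        push_cast at h2; linarith
      rw [ArithmeticFunction.moebius_eq_zero_of_not_squarefree]
      · simp
      · intro hsq
        exact hp.one_lt.ne' (Nat.isUnit_iff.1 (hsq p (mul_dvd_mul_left p hm)))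
    · intro m hm
      simp only [mem_filter, mem_Icc, mem_insert, forall_eq_or_imp] at hm
      obtain ⟨⟨h1, h2⟩, h3, h4⟩ := hm
      have hcop : Nat.Coprime p m := (Nat.Prime.coprime_iff_not_dvd hp).2 h3
      rw [ArithmeticFunction.isMultiplicative_moebius.map_mul_of_coprime hcop,
        ArithmeticFunction.moebius_apply_prime hp]
      push_cast
      rw [div_div]
      have hm0 : (m : ℝ) ≠ 0 := by positivity
      field_simp
  rw [hfirst, hsecond] at hsplit
  simp only [moebiusLogSqSum] at hsplit ⊢
  linarith

theorem eulerWeight_insert {P : Finset ℕ} {p : ℕ} (hpP : p ∉ P) :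
    eulerWeight (insert p P) = (1 - 1 / (p : ℝ))⁻¹ * eulerWeight P := by
  simp [eulerWeight, Finset.prod_insert hpP]

theorem one_le_eulerWeight {P : Finset ℕ} (hP : ∀ q ∈ P, q.Prime) : 1 ≤ eulerWeight P := by
  refine Finset.prod_induction _ (fun x : ℝ => 1 ≤ x) (fun _ _ => one_le_mul_of_one_le_of_one_le)
    le_rfl fun p hp => ?_
  have h1 : (1 : ℝ) < p := by exact_mod_cast (hP p hp).one_lt
  rw [one_le_inv₀ (sub_pos.2 ((div_lt_one (by linarith)).2 h1))]
  have : 0 ≤ 1 / (p : ℝ) := by positivity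
  linarith

theorem moebiusLogSqMain_insert {P : Finset ℕ} {p : ℕ} (hp : p.Prime)
    (hpP : p ∉ P) {X : ℝ} (hX : 0 < X) :
    moebiusLogSqMain (insert p P) X =
      moebiusLogSqMain P X + 1 / p * moebiusLogSqMain (insert p P) (X / p) := by
  have h1 : (1 : ℝ) < p := by exact_mod_cast hp.one_lt
  have h2 : (p : ℝ) - 1 ≠ 0 := by linarith
  have h3 : (p : ℝ) ≠ 0 := by linarith
  simp only [moebiusLogSqMain, eulerWeight_insert hpP, Finset.sum_insert hpP]
  rw [Real.log_div hX.ne' h3]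
  have : (1 - 1 / (p : ℝ))⁻¹ = p / (p - 1) := by field_simp
  rw [this]
  field_simp
  ring

/-- A bound for the error term without coprimality condition yields one for every `P`. -/
theorem abs_moebiusLogSqSum_sub_main_le {P : Finset ℕ} (hP : ∀ q ∈ P, q.Prime) {a b : ℝ}
    (h : ∀ Y : ℝ, 0 < Y → |moebiusLogSqSum ∅ Y - moebiusLogSqMain ∅ Y| ≤
      a + b * Y ^ (-(1 / 2) : ℝ)) {X : ℝ} (hX : 0 < X) :
    |moebiusLogSqSum P X - moebiusLogSqMain P X| ≤
      a * eulerWeight P + b * (∏ p ∈ P, (1 - (p : ℝ) ^ (-(1 / 2) : ℝ))⁻¹) *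
        X ^ (-(1 / 2) : ℝ) := by
  induction P using Finset.induction_on generalizing X with
  | empty => simpa [eulerWeight] using h X hX
  | insert p P hpP ih =>
    have hPP : ∀ q ∈ P, q.Prime := fun q hq => hP q (mem_insert_of_mem hq)
    have hp : p.Prime := hP p (mem_insert_self _ _)
    have h1 : (1 : ℝ) < p := by exact_mod_cast hp.one_lt
    have h0 : (0 : ℝ) < p := by linarith
    set D : ℝ → ℝ := fun Y => moebiusLogSqSum (insert p P) Y - moebiusLogSqMain (insert p P) Y
      with hD
    set D₀ : ℝ → ℝ := fun Y => moebiusLogSqSum P Y - moebiusLogSqMain P Y with hD₀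
    have hrec : ∀ Y, 0 < Y → D Y = D₀ Y + 1 / p * D (Y / p) := by
      intro Y hY
      have e1 := moebiusLogSqSum_insert hp hPP hpP hY
      have e2 := moebiusLogSqMain_insert hp hpP hY
      simp only [hD, hD₀]
      linarith
    have hiter : ∀ K : ℕ, D X = ∑ k ∈ range K, (1 / (p : ℝ)) ^ k * D₀ (X / p ^ k) +
        (1 / (p : ℝ)) ^ K * D (X / p ^ K) := by
      intro K
      induction K with
      | zero => simp
      | succ K ihK =>
        rw [Finset.sum_range_succ, ihK, hrec (X / p ^ K) (by positivity), div_div, ← pow_succ]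
        ring
    set A := a * eulerWeight P
    set B := b * ∏ p ∈ P, (1 - (p : ℝ) ^ (-(1 / 2) : ℝ))⁻¹
    set u := 1 / (p : ℝ) with hu
    set w := (p : ℝ) ^ (-(1 / 2) : ℝ) with hw
    have hu0 : 0 < u := by positivity
    have hu1 : u < 1 := (div_lt_one h0).2 h1
    have hw0 : 0 < w := by positivity
    have hw1 : w < 1 := Real.rpow_lt_one_of_one_lt_of_neg h1 (by norm_num)
    have hww : w * w = u := by
      rw [hw, ← Real.rpow_add h0]; norm_num [hu, Real.rpow_neg_one]
    have hterm : ∀ k : ℕ, |u ^ k * D₀ (X / p ^ k)| ≤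
        A * u ^ k + B * X ^ (-(1 / 2) : ℝ) * w ^ k := by
      intro k
      have := ih hPP (X := X / p ^ k) (by positivity)
      rw [abs_mul, abs_of_nonneg (by positivity)]
      calc u ^ k * |D₀ (X / p ^ k)| ≤
          u ^ k * (A + B * (X / p ^ k) ^ (-(1 / 2) : ℝ)) := by gcongr
        _ = _ := by
          have hpk : ((p : ℝ) ^ k) ^ (-(1 / 2) : ℝ) = w ^ k := by
            rw [hw, Real.rpow_pow_comm h0.le]
          rw [Real.div_rpow hX.le (by positivity), hpk, ← hww]
          field_simp
          ring
    have hs1 : Summable fun k : ℕ => A * u ^ k :=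
      (summable_geometric_of_lt_one hu0.le hu1).mul_left A
    have hs2 : Summable fun k : ℕ => B * X ^ (-(1 / 2) : ℝ) * w ^ k :=
      (summable_geometric_of_lt_one hw0.le hw1).mul_left _
    have hsum : Summable fun k : ℕ => u ^ k * D₀ (X / p ^ k) :=
      Summable.of_norm_bounded (hs1.add hs2) hterm
    have hrem : Filter.Tendsto (fun K : ℕ => u ^ K * D (X / p ^ K)) Filter.atTop (nhds 0) := by
      set c₁ := 2 * eulerWeight (insert p P)
      set c₂ := Real.log X - Real.eulerMascheroniConstant -
        ∑ p ∈ insert p P, Real.log p / ((p : ℝ) - 1) with hc₂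
      have hlim : Filter.Tendsto (fun K : ℕ => -(c₁ * c₂) * u ^ K +
          c₁ * Real.log p * ((K : ℝ) * u ^ K)) Filter.atTop (nhds 0) := by
        have t1 := (tendsto_pow_atTop_nhds_zero_of_lt_one hu0.le hu1).const_mul (-(c₁ * c₂))
        have t2 := (tendsto_self_mul_const_pow_of_lt_one hu0.le hu1).const_mul (c₁ * Real.log p)
        simpa using t1.add t2
      refine hlim.congr' ?_
      have hev : ∀ᶠ K : ℕ in Filter.atTop, X < (p : ℝ) ^ K :=
        (tendsto_pow_atTop_atTop_of_one_lt h1).eventually_gt_atTop X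
      filter_upwards [hev] with K hK
      simp only [hD]
      rw [moebiusLogSqSum_of_lt_one _ ((div_lt_one (by positivity)).2 hK), moebiusLogSqMain,
        Real.log_div hX.ne' (by positivity), Real.log_pow, hc₂]
      ring
    have hDsum : D X = ∑' k, u ^ k * D₀ (X / p ^ k) := by
      have t := hsum.hasSum.tendsto_sum_nat.add hrem
      rw [add_zero] at t
      exact tendsto_nhds_unique (tendsto_const_nhds.congr hiter) t
    change |D X| ≤ _
    rw [hDsum]
    rw [← Real.norm_eq_abs]
    calc ‖∑' k, u ^ k * D₀ (X / p ^ k)‖ ≤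
        ∑' k : ℕ, (A * u ^ k + B * X ^ (-(1 / 2) : ℝ) * w ^ k) :=
          tsum_of_norm_bounded (hs1.add hs2).hasSum hterm
      _ = A * (1 - u)⁻¹ + B * X ^ (-(1 / 2) : ℝ) * (1 - w)⁻¹ := by
        rw [hs1.tsum_add hs2, tsum_mul_left, tsum_mul_left,
          tsum_geometric_of_lt_one hu0.le hu1, tsum_geometric_of_lt_one hw0.le hw1]
      _ = _ := by
        rw [eulerWeight_insert hpP, Finset.prod_insert hpP]
        ring

theorem abs_moebiusLogSqSum_empty_le {Y : ℝ} (hY : 1 ≤ Y) :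
    |moebiusLogSqSum ∅ Y| ≤ (1 + Real.log Y) * Real.log Y ^ 2 := by
  have hlog : 0 ≤ Real.log Y := Real.log_nonneg hY
  have hharm : ∑ n ∈ Icc 1 ⌊Y⌋₊, (1 : ℝ) / n ≤ 1 + Real.log Y := by
    have := harmonic_floor_le_one_add_log Y hY
    rw [harmonic_eq_sum_Icc] at this
    push_cast at this
    simpa using this
  calc |moebiusLogSqSum ∅ Y| ≤ ∑ n ∈ Icc 1 ⌊Y⌋₊, 1 / (n : ℝ) * Real.log Y ^ 2 := by
        simp only [moebiusLogSqSum, notMem_empty, IsEmpty.forall_iff, implies_true, filter_true]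
        refine (Finset.abs_sum_le_sum_abs _ _).trans (Finset.sum_le_sum fun n hn => ?_)
        rw [mem_Icc, Nat.le_floor_iff (by linarith)] at hn
        have hn1 : (1 : ℝ) ≤ n := by exact_mod_cast hn.1
        rw [abs_mul, abs_div, Nat.abs_cast, abs_pow]
        have hμ : |((ArithmeticFunction.moebius n : ℤ) : ℝ)| ≤ 1 := by
          exact_mod_cast ArithmeticFunction.abs_moebius_le_one
        have h0 : 0 ≤ Real.log (Y / n) := Real.log_nonneg ((one_le_div (by linarith)).2 hn.2)
        have h1 : Real.log (Y / n) ≤ Real.log Y :=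
          Real.log_le_log (by positivity) (div_le_self (by linarith) hn1)
        rw [abs_of_nonneg h0]
        gcongr
    _ ≤ _ := by
        rw [← Finset.sum_mul]
        gcongr

theorem moebiusLogSqSum_empty_exp_eq {N : ℕ} {x : ℝ} (hN : Real.exp x ≤ N) :
    moebiusLogSqSum ∅ (Real.exp x) = ∑ n ∈ range (N + 1),
      ((ArithmeticFunction.moebius n : ℤ) : ℝ) / n * max (x - Real.log n) 0 ^ 2 := by
  simp only [moebiusLogSqSum, notMem_empty, IsEmpty.forall_iff, implies_true, filter_true]
  have hsub : Icc 1 ⌊Real.exp x⌋₊ ⊆ range (N + 1) := by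
    intro n hn
    rw [mem_Icc] at hn
    have : ⌊Real.exp x⌋₊ ≤ N := Nat.floor_le_of_le hN
    rw [mem_range]
    omega
  rw [← Finset.sum_subset hsub]
  · refine Finset.sum_congr rfl fun n hn => ?_
    rw [mem_Icc, Nat.le_floor_iff (Real.exp_pos x).le] at hn
    have hn0 : (0 : ℝ) < n := by exact_mod_cast hn.1
    rw [Real.log_div (Real.exp_pos x).ne' hn0.ne', Real.log_exp,
      max_eq_left (sub_nonneg.2 ((Real.log_le_iff_le_exp hn0).2 hn.2))]
  · intro n _ hn
    rcases Nat.eq_zero_or_pos n with rfl | hpos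
    · simp
    · rw [mem_Icc, Nat.le_floor_iff (Real.exp_pos x).le, not_and, not_le] at hn
      have hn0 : (0 : ℝ) < n := by exact_mod_cast hpos
      rw [max_eq_right (sub_nonpos.2 ((Real.le_log_iff_exp_le hn0).2 (hn hpos).le))]
      simp

theorem hasSum_moebiusLogSqSum_empty_exp (x : ℝ) :
    HasSum (fun n : ℕ => ((ArithmeticFunction.moebius n : ℤ) : ℝ) / n *
      max (x - Real.log n) 0 ^ 2) (moebiusLogSqSum ∅ (Real.exp x)) := by
  rw [moebiusLogSqSum_empty_exp_eq (Nat.le_ceil (Real.exp x))]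
  refine hasSum_sum_of_ne_finset_zero fun n hn => ?_
  rw [mem_range, not_lt] at hn
  have hle : Real.exp x ≤ n := (Nat.le_ceil _).trans (by exact_mod_cast (by omega))
  have hn0 : (0 : ℝ) < n := (Real.exp_pos x).trans_le hle
  rw [max_eq_right (sub_nonpos.2 ((Real.le_log_iff_exp_le hn0).2 hle))]
  simp

theorem continuous_moebiusLogSqSum_empty_exp :
    Continuous fun x : ℝ => moebiusLogSqSum ∅ (Real.exp x) := by
  refine continuous_iff_continuousAt.2 fun x => ?_
  have hev : (fun y : ℝ => moebiusLogSqSum ∅ (Real.exp y)) =ᶠ[nhds x]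
      fun y => ∑ n ∈ range (⌈Real.exp (x + 1)⌉₊ + 1),
        ((ArithmeticFunction.moebius n : ℤ) : ℝ) / n * max (y - Real.log n) 0 ^ 2 := by
    filter_upwards [Iio_mem_nhds (lt_add_one x)] with y hy
    exact moebiusLogSqSum_empty_exp_eq ((Real.exp_le_exp.2 (le_of_lt hy)).trans (Nat.le_ceil _))
  refine ContinuousAt.congr (Continuous.continuousAt ?_) hev.symm
  fun_prop

/-- The error term of `moebiusLogSqSum ∅ (exp x)`. -/
noncomputable def moebiusLogSqError (x : ℝ) : ℝ :=
  moebiusLogSqSum ∅ (Real.exp x) - 2 * x + 2 * Real.eulerMascheroniConstant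

theorem continuous_moebiusLogSqError : Continuous moebiusLogSqError := by
  unfold moebiusLogSqError
  have := continuous_moebiusLogSqSum_empty_exp
  fun_prop

theorem integrableOn_pow_mul_exp_neg {σ : ℝ} (hσ : 0 < σ) (k : ℕ) :
    MeasureTheory.IntegrableOn (fun x : ℝ => x ^ k * Real.exp (-σ * x)) (Set.Ioi 0) := by
  refine integrable_of_isBigO_exp_neg (half_pos hσ) (by fun_prop) ?_
  have h := (isLittleO_pow_exp_pos_mul_atTop k (half_pos hσ)).isBigO.mul
    (Asymptotics.isBigO_refl (fun x : ℝ => Real.exp (-σ * x)) Filter.atTop)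
  refine h.congr_right fun x => ?_
  rw [← Real.exp_add]
  congr 1
  ring

theorem integrableOn_pow_mul_cexp_neg {s : ℂ} (hs : 0 < s.re) (k : ℕ) :
    MeasureTheory.IntegrableOn (fun x : ℝ => (x : ℂ) ^ k * Complex.exp (-s * x)) (Set.Ioi 0) := by
  refine (MeasureTheory.integrable_norm_iff (by fun_prop)).1 ?_
  refine MeasureTheory.IntegrableOn.congr_fun (integrableOn_pow_mul_exp_neg hs k) (fun x hx => ?_)
    measurableSet_Ioi
  rw [Set.mem_Ioi] at hx
  simp [Complex.norm_exp, abs_of_pos hx]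

theorem integral_quadratic_mul_cexp_neg {s : ℂ} (hs : 0 < s.re) (a b c : ℂ) :
    ∫ x : ℝ in Set.Ioi 0, (a + b * x + c * x ^ 2) * Complex.exp (-s * x) =
      a / s + b / s ^ 2 + 2 * c / s ^ 3 := by
  have hs0 : s ≠ 0 := by rintro rfl; simp at hs
  have hintegrable : MeasureTheory.IntegrableOn
      (fun x : ℝ => (a + b * x + c * (x : ℂ) ^ 2) * Complex.exp (-s * x)) (Set.Ioi 0) := by
    have h := (((integrableOn_pow_mul_cexp_neg hs 0).const_mul a).add
      ((integrableOn_pow_mul_cexp_neg hs 1).const_mul b)).add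
      ((integrableOn_pow_mul_cexp_neg hs 2).const_mul c)
    refine MeasureTheory.IntegrableOn.congr_fun h (fun x _ => ?_) measurableSet_Ioi
    simp only [Pi.add_apply]
    ring
  set f : ℝ → ℂ := fun x => -((a / s + b / s ^ 2 + 2 * c / s ^ 3) + (b / s + 2 * c / s ^ 2) * x +
    c / s * x ^ 2) * Complex.exp (-s * x) with hf
  have hderiv : ∀ x ∈ Set.Ici (0 : ℝ),
      HasDerivAt f ((a + b * x + c * x ^ 2) * Complex.exp (-s * x)) x := by
    intro x _
    have hx : HasDerivAt (fun y : ℝ => (y : ℂ)) 1 x := Complex.ofRealCLM.hasDerivAt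
    have h := (((((hx.const_mul (b / s + 2 * c / s ^ 2)).const_add
      (a / s + b / s ^ 2 + 2 * c / s ^ 3)).add ((hx.pow 2).const_mul (c / s))).neg).mul
      ((hx.const_mul (-s)).cexp))
    refine h.congr_deriv ?_
    simp only [Pi.add_apply, Pi.neg_apply, Pi.pow_apply]
    field_simp
    push_cast
    ring
  have hpow : ∀ k : ℕ, Filter.Tendsto (fun x : ℝ => (x : ℂ) ^ k * Complex.exp (-s * x))
      Filter.atTop (nhds 0) := by
    intro k
    rw [tendsto_zero_iff_norm_tendsto_zero]
    have h := tendsto_rpow_mul_exp_neg_mul_atTop_nhds_zero k s.re hs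
    refine h.congr' ?_
    filter_upwards [Filter.eventually_gt_atTop 0] with x hx
    simp [Complex.norm_exp, abs_of_pos hx]
  have hlim : Filter.Tendsto f Filter.atTop (nhds 0) := by
    have h := (((hpow 0).const_mul (-(a / s + b / s ^ 2 + 2 * c / s ^ 3))).add
      ((hpow 1).const_mul (-(b / s + 2 * c / s ^ 2)))).add ((hpow 2).const_mul (-(c / s)))
    simp only [mul_zero, add_zero] at h
    refine h.congr fun x => ?_
    simp only [hf]
    ring
  rw [MeasureTheory.integral_Ioi_of_hasDerivAt_of_tendsto' hderiv hintegrable hlim]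
  simp [hf]

theorem integrable_max_sq_mul_cexp_neg {s : ℂ} (hs : 0 < s.re) :
    MeasureTheory.Integrable
      (fun x : ℝ => ((max x 0 ^ 2 : ℝ) : ℂ) * Complex.exp (-s * x)) := by
  have h := (MeasureTheory.integrable_indicator_iff measurableSet_Ioi).2
    (integrableOn_pow_mul_cexp_neg hs 2)
  refine h.congr (Filter.Eventually.of_forall fun x => ?_)
  rcases le_or_gt x 0 with hx | hx
  · simp [hx]
  · simp [hx, hx.le]

theorem integral_max_sq_mul_cexp_neg {s : ℂ} (hs : 0 < s.re) :
    ∫ x : ℝ, ((max x 0 ^ 2 : ℝ) : ℂ) * Complex.exp (-s * x) = 2 / s ^ 3 := by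
  have h := integral_quadratic_mul_cexp_neg hs 0 0 1
  rw [← MeasureTheory.integral_indicator measurableSet_Ioi] at h
  simp only [zero_div, mul_one, zero_add] at h
  rw [← h]
  refine MeasureTheory.integral_congr_ae (Filter.Eventually.of_forall fun x => ?_)
  rcases le_or_gt x 0 with hx | hx
  · simp [hx]
  · simp [hx, hx.le]

theorem moebiusLogSqSum_empty_exp_of_nonpos {x : ℝ} (hx : x ≤ 0) :
    moebiusLogSqSum ∅ (Real.exp x) = 0 := by
  refine (hasSum_moebiusLogSqSum_empty_exp x).unique ?_
  convert hasSum_zero with n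
  rw [max_eq_right (by linarith [Real.log_natCast_nonneg n])]
  simp

theorem integral_moebiusLogSqSum_mul_cexp_neg {s : ℂ} (hs : 0 < s.re) :
    ∫ x : ℝ in Set.Ioi 0, (moebiusLogSqSum ∅ (Real.exp x) : ℂ) * Complex.exp (-s * x) =
      2 / (s ^ 3 * riemannZeta (1 + s)) := by
  have hs1 : 1 < (1 + s).re := by simpa using hs
  set φ : ℝ → ℂ := fun x => ((max x 0 ^ 2 : ℝ) : ℂ) * Complex.exp (-s * x) with hφ
  set μ : ℕ → ℂ := fun n => ((ArithmeticFunction.moebius n : ℤ) : ℂ) with hμ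
  have hterm : ∀ (n : ℕ) (x : ℝ), ((((ArithmeticFunction.moebius n : ℤ) : ℝ) / n *
      max (x - Real.log n) 0 ^ 2 : ℝ) : ℂ) * Complex.exp (-s * x) =
      LSeries.term μ (1 + s) n * φ (x - Real.log n) := by
    intro n x
    rcases eq_or_ne n 0 with rfl | hn
    · simp
    · have hn0 : (n : ℂ) ≠ 0 := by exact_mod_cast hn
      have hexp : Complex.exp (-s * x) =
          Complex.exp (-s * (x - Real.log n : ℝ)) / (n : ℂ) ^ s := by
        rw [Complex.cpow_def_of_ne_zero hn0, ← Complex.exp_sub, ← Complex.natCast_log]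
        congr 1
        push_cast
        ring
      rw [LSeries.term_of_ne_zero hn, Complex.cpow_add _ _ hn0, Complex.cpow_one, hφ, hexp, hμ]
      push_cast
      field_simp
  have hintegrable := integrable_max_sq_mul_cexp_neg hs
  have hsum : Summable (LSeries.term μ (1 + s)) :=
    ArithmeticFunction.LSeriesSummable_moebius_iff.2 hs1
  have h := MeasureTheory.hasSum_integral_of_summable_integral_norm
    (F := fun (n : ℕ) (x : ℝ) => LSeries.term μ (1 + s) n * φ (x - Real.log n))
    (μ := MeasureTheory.volume)
    (fun n => (hintegrable.comp_sub_right _).const_mul _) (by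
      simp_rw [norm_mul, MeasureTheory.integral_const_mul,
        MeasureTheory.integral_sub_right_eq_self (fun x => ‖φ x‖)]
      exact hsum.norm.mul_right _)
  simp_rw [MeasureTheory.integral_const_mul, MeasureTheory.integral_sub_right_eq_self φ] at h
  have hL : riemannZeta (1 + s) * LSeries μ (1 + s) = 1 := by
    rw [← LSeries_one_eq_riemannZeta hs1]
    exact LSeries_one_mul_Lseries_moebius hs1
  have hval := h.unique (hsum.hasSum.mul_right (∫ x, φ x))
  have hzeta : riemannZeta (1 + s) ≠ 0 := left_ne_zero_of_mul_eq_one hL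
  have hs0 : s ≠ 0 := by rintro rfl; simp at hs
  rw [MeasureTheory.setIntegral_eq_integral_of_forall_compl_eq_zero]
  · trans ∫ x : ℝ, ∑' n : ℕ, LSeries.term μ (1 + s) n * φ (x - Real.log n)
    · refine MeasureTheory.integral_congr_ae (Filter.Eventually.of_forall fun x => ?_)
      have := ((Complex.hasSum_ofReal.2 (hasSum_moebiusLogSqSum_empty_exp x)).mul_right
        (Complex.exp (-s * x)))
      simp_rw [hterm] at this
      exact this.tsum_eq.symm
    · rw [hval, integral_max_sq_mul_cexp_neg hs]
      change LSeries μ (1 + s) * _ = _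
      rw [eq_div_of_mul_eq hzeta ((mul_comm _ _).trans hL)]
      field_simp
  · intro x hx
    rw [moebiusLogSqSum_empty_exp_of_nonpos (not_lt.1 hx)]
    simp

theorem integrableOn_pow_mul_moebiusLogSqError_mul_cexp_neg {s : ℂ} (hs : 0 < s.re) (k : ℕ) :
    MeasureTheory.IntegrableOn
      (fun x : ℝ => (x : ℂ) ^ k * moebiusLogSqError x * Complex.exp (-s * x)) (Set.Ioi 0) := by
  have hγ : 0 < Real.eulerMascheroniConstant :=
    lt_trans (by norm_num) Real.one_half_lt_eulerMascheroniConstant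
  have hcont := continuous_moebiusLogSqError
  have hdom : MeasureTheory.IntegrableOn (fun x : ℝ => x ^ (k + 2) * Real.exp (-s.re * x) +
      x ^ (k + 3) * Real.exp (-s.re * x) + 2 * (x ^ (k + 1) * Real.exp (-s.re * x)) +
      2 * Real.eulerMascheroniConstant * (x ^ k * Real.exp (-s.re * x))) (Set.Ioi 0) :=
    (((integrableOn_pow_mul_exp_neg hs _).add (integrableOn_pow_mul_exp_neg hs _)).add
      ((integrableOn_pow_mul_exp_neg hs _).const_mul _)).add
      ((integrableOn_pow_mul_exp_neg hs _).const_mul _)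
  refine hdom.mono' (by fun_prop) ?_
  filter_upwards [MeasureTheory.ae_restrict_mem measurableSet_Ioi] with x hx
  rw [Set.mem_Ioi] at hx
  have hF := abs_moebiusLogSqSum_empty_le (Real.one_le_exp hx.le)
  rw [Real.log_exp] at hF
  have hE : |moebiusLogSqError x| ≤
      (1 + x) * x ^ 2 + 2 * x + 2 * Real.eulerMascheroniConstant := by
    rw [moebiusLogSqError, abs_le] at *
    constructor <;> linarith [hF.1, hF.2]
  rw [norm_mul, norm_mul, norm_pow, Complex.norm_real, Complex.norm_real, Complex.norm_exp,
    Real.norm_eq_abs, Real.norm_eq_abs, abs_of_pos hx]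
  have hre : (-s * (x : ℂ)).re = -s.re * x := by simp
  rw [hre]
  calc x ^ k * |moebiusLogSqError x| * Real.exp (-s.re * x) ≤
      x ^ k * ((1 + x) * x ^ 2 + 2 * x + 2 * Real.eulerMascheroniConstant) *
        Real.exp (-s.re * x) := by gcongr
    _ = _ := by ring

/-- The Laplace transform of `moebiusLogSqError`. -/
noncomputable def moebiusLogSqLaplace (s : ℂ) : ℂ :=
  2 / (s ^ 3 * riemannZeta (1 + s)) - 2 / s ^ 2 + 2 * Real.eulerMascheroniConstant / s

theorem integral_moebiusLogSqError_mul_cexp_neg {s : ℂ} (hs : 0 < s.re) :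
    ∫ x : ℝ in Set.Ioi 0, (moebiusLogSqError x : ℂ) * Complex.exp (-s * x) =
      moebiusLogSqLaplace s := by
  have h0 := integrableOn_pow_mul_moebiusLogSqError_mul_cexp_neg hs 0
  have h1 : MeasureTheory.IntegrableOn (fun x : ℝ =>
      (-2 * (Real.eulerMascheroniConstant : ℂ) + 2 * x + 0 * (x : ℂ) ^ 2) *
        Complex.exp (-s * x)) (Set.Ioi 0) := by
    refine MeasureTheory.IntegrableOn.congr_fun
      (((integrableOn_pow_mul_cexp_neg hs 0).const_mul
        (-2 * (Real.eulerMascheroniConstant : ℂ))).add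
      ((integrableOn_pow_mul_cexp_neg hs 1).const_mul 2)) (fun x _ => ?_) measurableSet_Ioi
    simp only [Pi.add_apply]
    ring
  have hsum := MeasureTheory.integral_add h0 h1
  rw [integral_quadratic_mul_cexp_neg hs] at hsum
  have hF := integral_moebiusLogSqSum_mul_cexp_neg hs
  have hcongr : ∫ x : ℝ in Set.Ioi 0,
      ((x : ℂ) ^ 0 * moebiusLogSqError x * Complex.exp (-s * x) +
      (-2 * (Real.eulerMascheroniConstant : ℂ) + 2 * x + 0 * (x : ℂ) ^ 2) *
        Complex.exp (-s * x)) =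
      ∫ x : ℝ in Set.Ioi 0, (moebiusLogSqSum ∅ (Real.exp x) : ℂ) * Complex.exp (-s * x) := by
    congr 1
    ext x
    rw [moebiusLogSqError]
    push_cast
    ring
  rw [hcongr, hF] at hsum
  simp only [pow_zero, one_mul] at hsum
  rw [moebiusLogSqLaplace]
  linear_combination -hsum

theorem hasDerivAt_moebiusLogSqLaplace {s : ℂ} (hs : s ≠ 0) (hz : riemannZeta (1 + s) ≠ 0) :
    HasDerivAt moebiusLogSqLaplace
      (-6 / (s ^ 4 * riemannZeta (1 + s)) -
        2 * deriv riemannZeta (1 + s) / (s ^ 3 * riemannZeta (1 + s) ^ 2) + 4 / s ^ 3 -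
        2 * Real.eulerMascheroniConstant / s ^ 2) s := by
  have hζ : HasDerivAt (fun z => riemannZeta (1 + z)) (deriv riemannZeta (1 + s)) s :=
    (differentiableAt_riemannZeta (s := 1 + s) (by simpa using hs)).hasDerivAt.comp_const_add 1 s
  have hid := hasDerivAt_id s
  have h := ((((hid.pow 3).mul hζ).inv (mul_ne_zero (pow_ne_zero 3 hs) hz)).const_mul 2).sub
    ((((hid.pow 2).inv (pow_ne_zero 2 hs)).const_mul 2)) |>.add
    ((hid.inv hs).const_mul (2 * (Real.eulerMascheroniConstant : ℂ)))
  refine (h.congr_deriv ?_).congr_of_eventuallyEq (Filter.Eventually.of_forall fun z => ?_)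
  · simp only [Pi.mul_apply, Pi.pow_apply, id]
    field_simp
    ring
  · simp [moebiusLogSqLaplace, div_eq_mul_inv]

/-- The singularity of `moebiusLogSqLaplace` at the origin is removable. -/
theorem exists_differentiableOn_eq_moebiusLogSqLaplace :
    ∃ (U : Set ℂ) (h : ℂ → ℂ), IsOpen U ∧ (∀ s : ℂ, 0 ≤ s.re → s ∈ U) ∧
      DifferentiableOn ℂ h U ∧ ∀ s ≠ 0, h s = moebiusLogSqLaplace s := by
  set U : Set ℂ := {s | riemannZeta₁ (1 + s) ≠ 0} with hU
  set k : ℂ → ℂ := fun s => (riemannZeta₁ (1 + s))⁻¹ with hk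
  have hdiff : Differentiable ℂ fun s : ℂ => riemannZeta₁ (1 + s) := by fun_prop
  have hopen : IsOpen U := isOpen_ne_fun hdiff.continuous continuous_const
  have hzeta : ∀ s : ℂ, s ≠ 0 → riemannZeta₁ (1 + s) = s * riemannZeta (1 + s) := by
    intro s hs
    rw [riemannZeta_eq_inv_sub_mul (by simpa using hs), add_sub_cancel_left,
      mul_inv_cancel_left₀ hs]
  have hmem : ∀ s : ℂ, 0 ≤ s.re → s ∈ U := by
    intro s hs
    rcases eq_or_ne s 0 with rfl | h0
    · simp [hU]
    · change riemannZeta₁ (1 + s) ≠ 0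
      rw [hzeta s h0]
      exact mul_ne_zero h0 (riemannZeta_ne_zero_of_one_le_re (by simpa using hs))
  have hU0 : U ∈ nhds (0 : ℂ) := hopen.mem_nhds (hmem 0 le_rfl)
  have hkdiff : DifferentiableOn ℂ k U := fun s hs => (hdiff s).inv hs |>.differentiableWithinAt
  have hk0 : k 0 = 1 := by simp [hk]
  have hkderiv : deriv k 0 = -Real.eulerMascheroniConstant := by
    have h1 : HasDerivAt (fun z => riemannZeta₁ (1 + z)) (deriv riemannZeta₁ (1 + 0)) 0 :=
      (differentiable_riemannZeta₁ (1 + 0)).hasDerivAt.comp_const_add 1 0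
    have h2 : deriv k 0 = _ := (h1.inv (by simp)).deriv
    rw [h2]
    simp
  have h1diff : DifferentiableOn ℂ (dslope k 0) U :=
    (Complex.differentiableOn_dslope hU0).2 hkdiff
  have h2diff : DifferentiableOn ℂ (dslope (dslope k 0) 0) U :=
    (Complex.differentiableOn_dslope hU0).2 h1diff
  refine ⟨U, fun s => 2 * dslope (dslope k 0) 0 s, hopen, hmem, h2diff.const_mul 2,
    fun s hs => ?_⟩
  simp only [dslope_of_ne _ hs, slope_def_field, dslope_same, hkderiv, hk0, sub_zero]
  rw [hk, moebiusLogSqLaplace]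
  simp only [hzeta s hs]
  by_cases hz : riemannZeta (1 + s) = 0
  · simp only [hz, mul_zero, inv_zero, div_zero]
    field_simp
    ring
  · field_simp
    ring

theorem exists_norm_deriv_moebiusLogSqLaplace_le : ∃ C : ℝ, ∀ s : ℂ, 0 < s.re → s.re ≤ 1 →
    1 ≤ |s.im| → ‖deriv moebiusLogSqLaplace s‖ ≤ C * (1 + s.im ^ 2)⁻¹ := by
  obtain ⟨C, hC1, hC⟩ := exists_norm_riemannZeta_le_rpow
  obtain ⟨c, hc0, hc⟩ := exists_le_norm_riemannZeta
  refine ⟨2 * (6 / c + 2 * C / c ^ 2 + 4 + 2), fun s hs0 hs1 ht => ?_⟩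
  have hs : s ≠ 0 := by rintro rfl; simp at hs0
  have hre : 1 < (1 + s).re := by simpa using hs0
  have hre2 : (1 + s).re ≤ 2 := by simp; linarith
  have him : (1 + s).im = s.im := by simp
  have hz : riemannZeta (1 + s) ≠ 0 := riemannZeta_ne_zero_of_one_le_re hre.le
  have hup := (hC (1 + s) hre hre2 (by rwa [him])).2
  have hlow := hc (1 + s) hre hre2 (by rwa [him])
  rw [him] at hup hlow
  rw [(hasDerivAt_moebiusLogSqLaplace hs hz).deriv]
  have hst : |s.im| ≤ ‖s‖ := Complex.abs_im_le_norm s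
  set t := |s.im| with ht_def
  have ht0 : 0 < t := by linarith
  set Z := ‖riemannZeta (1 + s)‖ with hZ
  have hZ0 : 0 < Z := norm_pos_iff.2 hz
  have hpow : (t ^ (4 / 9 : ℝ)) ≤ t ^ 2 := by
    rw [← Real.rpow_natCast t 2]
    exact Real.rpow_le_rpow_of_exponent_le ht (by norm_num)
  have hnine : t ^ (1 / 9 : ℝ) * (t ^ (4 / 9 : ℝ)) ^ 2 = t := by
    rw [← Real.rpow_natCast, ← Real.rpow_mul ht0.le, ← Real.rpow_add ht0]
    norm_num
  have hγ0 := Real.one_half_lt_eulerMascheroniConstant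
  have hγ1 := Real.eulerMascheroniConstant_lt_two_thirds
  have e1 : ‖-6 / (s ^ 4 * riemannZeta (1 + s))‖ ≤ 6 / c / t ^ 2 := by
    rw [norm_div, norm_mul, norm_pow, norm_neg, Complex.norm_ofNat, div_div]
    refine div_le_div_of_nonneg_left (by norm_num) (by positivity) ?_
    calc c * t ^ 2 ≤ (Z * t ^ (4 / 9 : ℝ)) * t ^ 2 := by gcongr
      _ ≤ (Z * t ^ 2) * t ^ 2 := by gcongr
      _ = t ^ 4 * Z := by ring
      _ ≤ _ := by gcongr
  have e2 : ‖2 * deriv riemannZeta (1 + s) / (s ^ 3 * riemannZeta (1 + s) ^ 2)‖ ≤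
      2 * C / c ^ 2 / t ^ 2 := by
    rw [norm_div, norm_mul, norm_mul, norm_pow, norm_pow, Complex.norm_ofNat, div_div]
    rw [div_le_div_iff₀ (by positivity) (by positivity)]
    calc 2 * ‖deriv riemannZeta (1 + s)‖ * (c ^ 2 * t ^ 2) ≤
        2 * (C * t ^ (1 / 9 : ℝ)) * ((Z * t ^ (4 / 9 : ℝ)) ^ 2 * t ^ 2) := by gcongr
      _ = 2 * C * (t ^ 2 * (t ^ (1 / 9 : ℝ) * (t ^ (4 / 9 : ℝ)) ^ 2) * Z ^ 2) := by ring
      _ = 2 * C * (t ^ 3 * Z ^ 2) := by rw [hnine]; ring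
      _ ≤ _ := by gcongr
  have e3 : ‖4 / s ^ 3‖ ≤ 4 / t ^ 2 := by
    rw [norm_div, norm_pow, Complex.norm_ofNat]
    refine div_le_div_of_nonneg_left (by norm_num) (by positivity) ?_
    calc t ^ 2 ≤ t ^ 3 := pow_le_pow_right₀ ht (by norm_num)
      _ ≤ _ := by gcongr
  have e4 : ‖2 * (Real.eulerMascheroniConstant : ℂ) / s ^ 2‖ ≤ 2 / t ^ 2 := by
    rw [norm_div, norm_mul, norm_pow, Complex.norm_ofNat, Complex.norm_real, Real.norm_eq_abs,
      abs_of_pos (by linarith)]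
    exact div_le_div₀ (by norm_num) (by linarith) (by positivity) (by gcongr)
  have htri := (norm_sub_le (-6 / (s ^ 4 * riemannZeta (1 + s)) -
    2 * deriv riemannZeta (1 + s) / (s ^ 3 * riemannZeta (1 + s) ^ 2) + 4 / s ^ 3)
    (2 * (Real.eulerMascheroniConstant : ℂ) / s ^ 2)).trans (add_le_add_left
    ((norm_add_le _ _).trans (add_le_add_left (norm_sub_le _ _) _)) _)
  have hsq : (1 : ℝ) / t ^ 2 ≤ 2 * (1 + s.im ^ 2)⁻¹ := by
    rw [← sq_abs s.im, ← ht_def, ← div_eq_mul_inv, div_le_div_iff₀ (by positivity) (by positivity)]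
    nlinarith
  calc _ ≤ 6 / c / t ^ 2 + 2 * C / c ^ 2 / t ^ 2 + 4 / t ^ 2 + 2 / t ^ 2 := by linarith
    _ = (6 / c + 2 * C / c ^ 2 + 4 + 2) * (1 / t ^ 2) := by ring
    _ ≤ (6 / c + 2 * C / c ^ 2 + 4 + 2) * (2 * (1 + s.im ^ 2)⁻¹) := by gcongr
    _ = _ := by ring

/-- The derivative of `moebiusLogSqLaplace` extends continuously to the closed right half-plane,
with quadratic decay in vertical strips. -/
theorem exists_continuousOn_eq_deriv_moebiusLogSqLaplace :
    ∃ (B : ℂ → ℂ) (C : ℝ), ContinuousOn B {s | 0 ≤ s.re} ∧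
      (∀ s : ℂ, 0 < s.re → HasDerivAt moebiusLogSqLaplace (-B s) s) ∧
      ∀ s : ℂ, 0 < s.re → s.re ≤ 1 → ‖B s‖ ≤ C * (1 + s.im ^ 2)⁻¹ := by
  obtain ⟨U, h, hU, hmem, hdiff, heq⟩ := exists_differentiableOn_eq_moebiusLogSqLaplace
  obtain ⟨C₁, hC₁⟩ := exists_norm_deriv_moebiusLogSqLaplace_le
  have hcont : ContinuousOn (fun s => -deriv h s) {s | 0 ≤ s.re} :=
    ((hdiff.deriv hU).continuousOn.mono hmem).neg
  have hderiv : ∀ s : ℂ, 0 < s.re → HasDerivAt moebiusLogSqLaplace (- -deriv h s) s := by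
    intro s hs
    have hs0 : s ≠ 0 := by rintro rfl; simp at hs
    rw [neg_neg]
    refine (hdiff.differentiableAt (hU.mem_nhds (hmem s hs.le))).hasDerivAt.congr_of_eventuallyEq ?_
    filter_upwards [isOpen_ne.mem_nhds hs0] with z hz using (heq z hz).symm
  obtain ⟨C₂, hC₂⟩ := (isCompact_Icc.reProdIm isCompact_Icc :
    IsCompact (Set.Icc (0 : ℝ) 1 ×ℂ Set.Icc (-1 : ℝ) 1)).exists_bound_of_continuousOn
    (hcont.mono fun s hs => hs.1.1)
  refine ⟨fun s => -deriv h s, max C₁ (2 * |C₂|), hcont, hderiv, fun s hs0 hs1 => ?_⟩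
  have hpos : 0 < (1 + s.im ^ 2)⁻¹ := by positivity
  rcases le_total 1 |s.im| with ht | ht
  · have := hC₁ s hs0 hs1 ht
    rw [(hderiv s hs0).deriv, norm_neg] at this
    exact this.trans (by gcongr; exact le_max_left _ _)
  · have h1 := hC₂ s ⟨⟨hs0.le, hs1⟩, abs_le.1 ht⟩
    have h2 : (1 : ℝ) ≤ 2 * (1 + s.im ^ 2)⁻¹ := by
      have : s.im ^ 2 ≤ 1 := (sq_le_one_iff_abs_le_one _).2 ht
      rw [← div_eq_mul_inv, one_le_div (by positivity)]
      linarith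
    calc ‖-deriv h s‖ ≤ |C₂| * 1 := by linarith [le_abs_self C₂]
      _ ≤ |C₂| * (2 * (1 + s.im ^ 2)⁻¹) := by gcongr
      _ = 2 * |C₂| * (1 + s.im ^ 2)⁻¹ := by ring
      _ ≤ _ := by gcongr; exact le_max_right _ _

open FourierTransform in
/-- Inverse Laplace transform along the line `re s = σ`, for the function `x * error x`. -/
theorem integral_cexp_mul_eq_mul_moebiusLogSqError {B : ℂ → ℂ} {C : ℝ}
    (hB : ContinuousOn B {s | 0 ≤ s.re})
    (hderiv : ∀ s : ℂ, 0 < s.re → HasDerivAt moebiusLogSqLaplace (-B s) s)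
    (hbound : ∀ s : ℂ, 0 < s.re → s.re ≤ 1 → ‖B s‖ ≤ C * (1 + s.im ^ 2)⁻¹)
    {σ x : ℝ} (hσ0 : 0 < σ) (hσ1 : σ ≤ 1) (hx : 0 < x) :
    ∫ w : ℝ, Complex.exp (2 * Real.pi * w * x * Complex.I) *
        B (σ + 2 * Real.pi * w * Complex.I) =
      x * moebiusLogSqError x * Complex.exp (-σ * x) := by
  have hre : ∀ w : ℝ, ((σ : ℂ) + 2 * Real.pi * w * Complex.I).re = σ := by intro w; simp
  have him : ∀ w : ℝ, ((σ : ℂ) + 2 * Real.pi * w * Complex.I).im = 2 * Real.pi * w := by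
    intro w; simp
  set f : ℝ → ℂ := (Set.Ioi (0 : ℝ)).indicator
    (fun x : ℝ => (moebiusLogSqError x : ℂ) * Complex.exp (-σ * x)) with hf
  have hf0 : MeasureTheory.Integrable f := by
    rw [hf, MeasureTheory.integrable_indicator_iff measurableSet_Ioi]
    simpa using integrableOn_pow_mul_moebiusLogSqError_mul_cexp_neg
      (s := σ) (by simpa using hσ0) 0
  have hf1 : MeasureTheory.Integrable (fun x : ℝ => x • f x) := by
    have h := (MeasureTheory.integrable_indicator_iff measurableSet_Ioi).2
      (integrableOn_pow_mul_moebiusLogSqError_mul_cexp_neg (s := σ) (by simpa using hσ0) 1)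
    refine h.congr (Filter.Eventually.of_forall fun y => ?_)
    by_cases hy : y ∈ Set.Ioi (0 : ℝ)
    · simp [hf, hy, mul_assoc]
    · simp [hf, hy]
  have hFf : 𝓕 f = fun w : ℝ => moebiusLogSqLaplace (σ + 2 * Real.pi * w * Complex.I) := by
    ext w
    rw [← integral_moebiusLogSqError_mul_cexp_neg (by rw [hre]; exact hσ0),
      Real.fourier_real_eq_integral_exp_smul,
      ← MeasureTheory.integral_indicator measurableSet_Ioi]
    refine MeasureTheory.integral_congr_ae (Filter.Eventually.of_forall fun y => ?_)
    by_cases hy : y ∈ Set.Ioi (0 : ℝ)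
    · simp only [hf, Set.indicator_of_mem hy, smul_eq_mul]
      rw [mul_left_comm, ← Complex.exp_add]
      congr 2
      push_cast
      ring
    · simp [hf, hy]
  have hFg : 𝓕 (fun y : ℝ => (-2 * Real.pi * Complex.I * y) • f y) =
      fun w : ℝ => -2 * Real.pi * Complex.I * B (σ + 2 * Real.pi * w * Complex.I) := by
    ext w
    have h1 := Real.hasDerivAt_fourier hf0 hf1 w
    rw [hFf] at h1
    have hline : HasDerivAt (fun w : ℝ => (σ : ℂ) + 2 * Real.pi * w * Complex.I)
        (2 * Real.pi * Complex.I) w := by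
      have hid : HasDerivAt (fun y : ℝ => (y : ℂ)) 1 w := Complex.ofRealCLM.hasDerivAt
      simpa using ((hid.const_mul (2 * (Real.pi : ℂ))).mul_const Complex.I).const_add (σ : ℂ)
    have h2 := (hderiv (σ + 2 * Real.pi * w * Complex.I) (by rw [hre]; exact hσ0)).comp w hline
    rw [h1.unique h2]
    ring
  have hBcont : Continuous fun w : ℝ => B (σ + 2 * Real.pi * w * Complex.I) :=
    hB.comp_continuous (by fun_prop) fun w => by
      change 0 ≤ ((σ : ℂ) + 2 * Real.pi * w * Complex.I).re
      rw [hre]; exact hσ0.le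
  have hBint : MeasureTheory.Integrable fun w : ℝ => B (σ + 2 * Real.pi * w * Complex.I) := by
    have hdom : MeasureTheory.Integrable fun w : ℝ => C * (1 + (2 * Real.pi * w) ^ 2)⁻¹ :=
      (integrable_inv_one_add_sq.comp_mul_left' (by positivity)).const_mul C
    refine hdom.mono' hBcont.aestronglyMeasurable (Filter.Eventually.of_forall fun w => ?_)
    have := hbound (σ + 2 * Real.pi * w * Complex.I) (by rw [hre]; exact hσ0) (by rwa [hre])
    rwa [him] at this
  have hgint : MeasureTheory.Integrable
      (fun y : ℝ => (-2 * Real.pi * Complex.I * y) • f y) := by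
    refine (hf1.const_mul (-2 * Real.pi * Complex.I)).congr
      (Filter.Eventually.of_forall fun y => ?_)
    simp [mul_assoc]
  have hgcont : ContinuousAt (fun y : ℝ => (-2 * Real.pi * Complex.I * y) • f y) x := by
    have hE := continuous_moebiusLogSqError
    have hcont : Continuous (fun y : ℝ => (-2 * Real.pi * Complex.I * y) •
        ((moebiusLogSqError y : ℂ) * Complex.exp (-σ * y))) := by fun_prop
    refine hcont.continuousAt.congr ?_
    filter_upwards [Ioi_mem_nhds hx] with y hy
    simp [hf, Set.indicator_of_mem hy]
  have hinv := hgint.fourierInv_fourier_eq (by rw [hFg]; exact hBint.const_mul _) hgcont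
  rw [hFg, Real.fourierInv_eq_fourier_neg, Real.fourier_real_eq_integral_exp_smul] at hinv
  have hπ : -2 * (Real.pi : ℂ) * Complex.I ≠ 0 := by simp [Real.pi_ne_zero]
  refine mul_left_cancel₀ hπ ?_
  rw [← MeasureTheory.integral_const_mul]
  calc _ = _ := by
        refine MeasureTheory.integral_congr_ae (Filter.Eventually.of_forall fun w => ?_)
        simp only [smul_eq_mul]
        rw [mul_left_comm]
        congr 3
        push_cast
        ring
    _ = _ := hinv
    _ = _ := by
        rw [hf, Set.indicator_of_mem (Set.mem_Ioi.2 hx), smul_eq_mul]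
        ring

open FourierTransform in
theorem tendsto_mul_moebiusLogSqSum_exp :
    Filter.Tendsto (fun x : ℝ => x * (moebiusLogSqSum ∅ (Real.exp x) - 2 * x +
      2 * Real.eulerMascheroniConstant)) Filter.atTop (nhds 0) := by
  obtain ⟨B, C, hB, hderiv, hbound⟩ := exists_continuousOn_eq_deriv_moebiusLogSqLaplace
  have hmem : ∀ σ w : ℝ, 0 ≤ σ →
      (σ : ℂ) + 2 * Real.pi * w * Complex.I ∈ {s : ℂ | 0 ≤ s.re} := by
    intro σ w hσ
    change 0 ≤ ((σ : ℂ) + 2 * Real.pi * w * Complex.I).re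
    simpa using hσ
  have hcont : ∀ σ : ℝ, 0 ≤ σ →
      Continuous fun w : ℝ => B (σ + 2 * Real.pi * w * Complex.I) := fun σ hσ =>
    hB.comp_continuous (by fun_prop) fun w => hmem σ w hσ
  have hboundary : ∀ x : ℝ, 0 < x →
      𝓕 (fun w : ℝ => B ((0 : ℝ) + 2 * Real.pi * w * Complex.I)) (-x) =
        ((x * moebiusLogSqError x : ℝ) : ℂ) := by
    intro x hx
    have hlim : Filter.Tendsto (fun σ : ℝ => ∫ w : ℝ,
        Complex.exp (2 * Real.pi * w * x * Complex.I) *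
          B (σ + 2 * Real.pi * w * Complex.I)) (nhdsWithin 0 (Set.Ioi 0))
        (nhds (∫ w : ℝ, Complex.exp (2 * Real.pi * w * x * Complex.I) *
          B ((0 : ℝ) + 2 * Real.pi * w * Complex.I))) := by
      have hdom : MeasureTheory.Integrable fun w : ℝ => C * (1 + (2 * Real.pi * w) ^ 2)⁻¹ :=
        (integrable_inv_one_add_sq.comp_mul_left' (by positivity)).const_mul C
      refine MeasureTheory.tendsto_integral_filter_of_dominated_convergence _ ?_ ?_ hdom ?_
      · filter_upwards [self_mem_nhdsWithin] with σ hσ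
        have := hcont σ (le_of_lt hσ)
        exact (Continuous.mul (by fun_prop) this).aestronglyMeasurable
      · filter_upwards [Ioc_mem_nhdsGT one_pos] with σ hσ
        refine Filter.Eventually.of_forall fun w => ?_
        have h := hbound (σ + 2 * Real.pi * w * Complex.I) (by simpa using hσ.1)
          (by simpa using hσ.2)
        rw [norm_mul, Complex.norm_exp]
        simpa using h
      · refine Filter.Eventually.of_forall fun w => Filter.Tendsto.const_mul _ ?_
        refine (hB _ (hmem 0 w le_rfl)).tendsto.comp (tendsto_nhdsWithin_iff.2 ⟨?_, ?_⟩)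
        · refine Filter.Tendsto.mono_left (Continuous.tendsto ?_ 0) nhdsWithin_le_nhds
          fun_prop
        · filter_upwards [self_mem_nhdsWithin] with σ hσ using hmem σ w (le_of_lt hσ)
    have hlim' : Filter.Tendsto (fun σ : ℝ =>
        (x : ℂ) * moebiusLogSqError x * Complex.exp (-σ * x)) (nhdsWithin 0 (Set.Ioi 0))
        (nhds ((x : ℂ) * moebiusLogSqError x * Complex.exp (-(0 : ℝ) * x))) := by
      refine Filter.Tendsto.mono_left (Continuous.tendsto ?_ 0) nhdsWithin_le_nhds
      fun_prop
    have hEq := tendsto_nhds_unique (hlim.congr' (by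
      filter_upwards [Ioc_mem_nhdsGT one_pos] with σ hσ
      exact integral_cexp_mul_eq_mul_moebiusLogSqError hB hderiv hbound hσ.1 hσ.2 hx)) hlim'
    rw [Real.fourier_real_eq_integral_exp_smul]
    simp only [Complex.ofReal_zero, neg_zero, zero_mul, Complex.exp_zero, mul_one] at hEq
    rw [Complex.ofReal_mul, ← hEq]
    refine MeasureTheory.integral_congr_ae (Filter.Eventually.of_forall fun w => ?_)
    simp
  have hRL := (Real.zero_at_infty_fourier
    (fun w : ℝ => B ((0 : ℝ) + 2 * Real.pi * w * Complex.I))).comp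
    (Filter.tendsto_neg_atTop_atBot.mono_right atBot_le_cocompact)
  have hre := (Complex.continuous_re.tendsto 0).comp hRL
  rw [Complex.zero_re] at hre
  refine hre.congr' ?_
  filter_upwards [Filter.eventually_gt_atTop 0] with x hx
  simp only [Function.comp_apply, hboundary x hx, Complex.ofReal_re, moebiusLogSqError]

/-- A bound for the error term of the unsieved sum, valid at every `Y > 0`, in terms of an
auxiliary large parameter `X`. -/
theorem exists_forall_abs_moebiusLogSqSum_empty_sub_main_le : ∃ C X₀ : ℝ, 0 < C ∧ 1 < X₀ ∧
    ∀ X : ℝ, X₀ ≤ X → ∀ Y : ℝ, 0 < Y → |moebiusLogSqSum ∅ Y - moebiusLogSqMain ∅ Y| ≤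
      1 / (2 * Real.log X) + C * X ^ (1 / 4 : ℝ) * Y ^ (-(1 / 2) : ℝ) := by
  have hmain : ∀ Y, moebiusLogSqMain ∅ Y =
      2 * Real.log Y - 2 * Real.eulerMascheroniConstant := by
    intro Y; simp [moebiusLogSqMain, eulerWeight]; ring
  have hγ0 := Real.one_half_lt_eulerMascheroniConstant
  have hγ1 := Real.eulerMascheroniConstant_lt_two_thirds
  have hev := tendsto_mul_moebiusLogSqSum_exp.eventually
    (Metric.ball_mem_nhds (0 : ℝ) (ε := 1 / 4) (by norm_num))
  obtain ⟨x₀, hx₀⟩ := Filter.eventually_atTop.1 (hev.and (Filter.eventually_ge_atTop 1))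
  have hx1 : 1 ≤ x₀ := (hx₀ x₀ le_rfl).2
  have hlarge : ∀ Y, Real.exp x₀ ≤ Y →
      |moebiusLogSqSum ∅ Y - moebiusLogSqMain ∅ Y| ≤ 1 / (4 * Real.log Y) := by
    intro Y hY
    have hY0 : 0 < Y := (Real.exp_pos _).trans_le hY
    have hl : x₀ ≤ Real.log Y := (Real.le_log_iff_exp_le hY0).2 hY
    have := (hx₀ _ hl).1
    rw [dist_zero_right, Real.exp_log hY0, Real.norm_eq_abs, abs_mul,
      abs_of_pos (by linarith : 0 < Real.log Y)] at this
    rw [hmain, le_div_iff₀ (by linarith)]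
    rw [sub_sub_eq_add_sub, add_sub_right_comm]
    linarith
  set C := (1 + x₀) * x₀ ^ 2 + 2 * x₀ + 6 with hC
  have hsmall : ∀ Y, 0 < Y → Y ≤ 1 →
      |moebiusLogSqSum ∅ Y - moebiusLogSqMain ∅ Y| ≤ C * Y ^ (-(1 / 2) : ℝ) := by
    intro Y hY hY1
    have h1 : 1 ≤ Y ^ (-(1 / 2) : ℝ) :=
      Real.one_le_rpow_of_pos_of_le_one_of_nonpos hY hY1 (by norm_num)
    have h2 : - Real.log Y ≤ 2 * Y ^ (-(1 / 2) : ℝ) := by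
      have := Real.log_le_rpow_div (inv_nonneg.2 hY.le) (ε := 1 / 2) (by norm_num)
      rw [Real.log_inv, Real.inv_rpow hY.le, ← Real.rpow_neg hY.le] at this
      linarith
    have h3 : Real.log Y ≤ 0 := Real.log_nonpos hY.le hY1
    have hS : moebiusLogSqSum ∅ Y = 0 := by
      rcases hY1.lt_or_eq with h | rfl
      · exact moebiusLogSqSum_of_lt_one _ h
      · simp [moebiusLogSqSum]
    have hC6 : 6 * Y ^ (-(1 / 2) : ℝ) ≤ C * Y ^ (-(1 / 2) : ℝ) := by
      gcongr
      have : 0 ≤ (1 + x₀) * x₀ ^ 2 := by positivity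
      linarith
    rw [hS, hmain, abs_le]
    constructor <;> linarith
  have hmid : ∀ Y, 1 ≤ Y → |moebiusLogSqSum ∅ Y - moebiusLogSqMain ∅ Y| ≤ C := by
    intro Y hY
    rcases le_total (Real.exp x₀) Y with h | h
    · refine (hlarge Y h).trans ?_
      have hl : x₀ ≤ Real.log Y := (Real.le_log_iff_exp_le (by linarith)).2 h
      have h1 : 1 / (4 * Real.log Y) ≤ 1 := by
        rw [div_le_one (by linarith)]; linarith
      have : 0 ≤ (1 + x₀) * x₀ ^ 2 := by positivity
      linarith
    · have hl0 : 0 ≤ Real.log Y := Real.log_nonneg hY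
      have hl : Real.log Y ≤ x₀ := (Real.log_le_iff_le_exp (by linarith)).2 h
      have h1 := abs_moebiusLogSqSum_empty_le hY
      have h2 : (1 + Real.log Y) * Real.log Y ^ 2 ≤ (1 + x₀) * x₀ ^ 2 := by gcongr
      rw [hmain]
      rw [abs_le] at h1 ⊢
      constructor <;> linarith
  have hC0 : 0 < C := by positivity
  refine ⟨C, Real.exp (2 * x₀), hC0, Real.one_lt_exp_iff.2 (by linarith), fun X hX Y hY => ?_⟩
  have hX0 : 0 < X := (Real.exp_pos _).trans_le hX
  have hlX : 2 * x₀ ≤ Real.log X := (Real.le_log_iff_exp_le hX0).2 hX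
  have hX1 : 1 ≤ X := (Real.one_le_exp (by linarith)).trans hX
  have hX4 : 1 ≤ X ^ (1 / 4 : ℝ) := Real.one_le_rpow hX1 (by norm_num)
  have hA : 0 ≤ 1 / (2 * Real.log X) := by
    have : 0 ≤ Real.log X := by linarith
    positivity
  have hB : 0 ≤ C * X ^ (1 / 4 : ℝ) * Y ^ (-(1 / 2) : ℝ) := by positivity
  rcases le_total Y 1 with h1 | h1
  · refine (hsmall Y hY h1).trans ?_
    have : C * 1 * Y ^ (-(1 / 2) : ℝ) ≤ C * X ^ (1 / 4 : ℝ) * Y ^ (-(1 / 2) : ℝ) := by gcongr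
    linarith
  rcases le_total (X ^ (1 / 2 : ℝ)) Y with h | h
  · have hl : Real.log X / 2 ≤ Real.log Y := by
      have := Real.log_le_log (by positivity) h
      rw [Real.log_rpow hX0] at this
      linarith
    refine (hlarge Y ((Real.le_log_iff_exp_le hY).1 (by linarith))).trans ?_
    have : 1 / (4 * Real.log Y) ≤ 1 / (2 * Real.log X) :=
      one_div_le_one_div_of_le (by linarith) (by linarith)
    linarith
  · refine (hmid Y h1).trans ?_
    have h2 : X ^ (-(1 / 4) : ℝ) ≤ Y ^ (-(1 / 2) : ℝ) := by
      have := Real.rpow_le_rpow_of_nonpos hY h (z := -(1 / 2)) (by norm_num)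
      rw [← Real.rpow_mul hX0.le] at this
      norm_num at this ⊢
      exact this
    have h3 : X ^ (1 / 4 : ℝ) * X ^ (-(1 / 4) : ℝ) = 1 := by
      rw [← Real.rpow_add hX0]; simp
    have : C * X ^ (1 / 4 : ℝ) * X ^ (-(1 / 4) : ℝ) ≤ C * X ^ (1 / 4 : ℝ) * Y ^ (-(1 / 2) : ℝ) := by
      gcongr
    rw [mul_assoc C, h3] at this
    linarith

/-- The Euler product `∏_{p ∣ v} (1 - p^{-1/2})⁻¹` grows slower than any power of `v`. -/
theorem exists_forall_prod_one_sub_rpow_inv_le {ε : ℝ} (hε : 0 < ε) : ∃ C : ℝ, 0 < C ∧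
    ∀ v : ℕ, v ≠ 0 →
      ∏ p ∈ v.primeFactors, (1 - (p : ℝ) ^ (-(1 / 2) : ℝ))⁻¹ ≤ C * (v : ℝ) ^ ε := by
  have hlim : Filter.Tendsto (fun p : ℕ => (1 - (p : ℝ) ^ (-(1 / 2) : ℝ))⁻¹)
      Filter.atTop (nhds 1) := by
    have := (tendsto_rpow_neg_atTop (y := 1 / 2) (by norm_num)).comp
      (tendsto_natCast_atTop_atTop (R := ℝ))
    simpa using (this.const_sub 1).inv₀ (by norm_num)
  have h2 : (1 : ℝ) < 2 ^ ε := Real.one_lt_rpow (by norm_num) hε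
  obtain ⟨z, hz⟩ := Filter.eventually_atTop.1 (hlim.eventually (gt_mem_nhds h2))
  have hge : ∀ p : ℕ, p.Prime → 1 ≤ (1 - (p : ℝ) ^ (-(1 / 2) : ℝ))⁻¹ := by
    intro p hp
    have h1 : (1 : ℝ) < p := by exact_mod_cast hp.one_lt
    have hw1 : (p : ℝ) ^ (-(1 / 2) : ℝ) < 1 :=
      Real.rpow_lt_one_of_one_lt_of_neg h1 (by norm_num)
    rw [one_le_inv₀ (by linarith)]
    have : 0 ≤ (p : ℝ) ^ (-(1 / 2) : ℝ) := by positivity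
    linarith
  set g : ℕ → ℝ := fun p => (1 - (p : ℝ) ^ (-(1 / 2) : ℝ))⁻¹ with hg
  set Q := (range z).filter Nat.Prime
  have hQ : 1 ≤ ∏ p ∈ Q, g p := Finset.prod_induction _ (fun x : ℝ => 1 ≤ x)
    (fun _ _ => one_le_mul_of_one_le_of_one_le) le_rfl fun p hp => hge p (mem_filter.1 hp).2
  refine ⟨∏ p ∈ Q, g p, by linarith, fun v hv => ?_⟩
  rw [← Finset.prod_filter_mul_prod_filter_not v.primeFactors (fun p => p < z)]
  have hfirst : ∏ p ∈ v.primeFactors.filter (fun p => p < z), g p ≤ ∏ p ∈ Q, g p := by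
    have hsub : v.primeFactors.filter (fun p => p < z) ⊆ Q := fun p hp => by
      rw [mem_filter] at hp
      exact mem_filter.2 ⟨mem_range.2 hp.2, Nat.prime_of_mem_primeFactors hp.1⟩
    rw [← Finset.prod_sdiff hsub]
    refine le_mul_of_one_le_left (Finset.prod_nonneg fun p hp => ?_)
      (Finset.prod_induction _ (fun x : ℝ => 1 ≤ x)
        (fun _ _ => one_le_mul_of_one_le_of_one_le) le_rfl fun p hp => ?_)
    · exact zero_le_one.trans (hge p (Nat.prime_of_mem_primeFactors (mem_filter.1 hp).1))
    · exact hge p (mem_filter.1 (mem_sdiff.1 hp).1).2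
  have hsecond : ∏ p ∈ v.primeFactors.filter (fun p => ¬ p < z), g p ≤ (v : ℝ) ^ ε := by
    calc ∏ p ∈ v.primeFactors.filter (fun p => ¬ p < z), g p
        ≤ ∏ p ∈ v.primeFactors.filter (fun p => ¬ p < z), (p : ℝ) ^ ε := by
          refine Finset.prod_le_prod (fun p hp => ?_) fun p hp => ?_
          · exact zero_le_one.trans (hge p (Nat.prime_of_mem_primeFactors (mem_filter.1 hp).1))
          · rw [mem_filter, not_lt] at hp
            have hp2 : (2 : ℝ) ≤ p := by
              exact_mod_cast (Nat.prime_of_mem_primeFactors hp.1).two_le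
            exact (hz p hp.2).le.trans (Real.rpow_le_rpow (by norm_num) hp2 hε.le)
      _ ≤ (v : ℝ) ^ ε := by
          rw [Real.finsetProd_rpow _ _ fun p _ => Nat.cast_nonneg p]
          refine Real.rpow_le_rpow (by positivity) ?_ hε.le
          rw [← Nat.cast_prod, Nat.cast_le]
          refine Nat.le_of_dvd (Nat.pos_of_ne_zero hv) ?_
          exact (Finset.prod_dvd_prod_of_subset _ _ _ (filter_subset _ _)).trans
            (Nat.prod_primeFactors_dvd v)
  refine mul_le_mul hfirst hsecond (Finset.prod_nonneg fun p hp => ?_) (by linarith)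
  exact zero_le_one.trans (hge p (Nat.prime_of_mem_primeFactors (mem_filter.1 hp).1))

theorem eulerWeight_primeFactors {v : ℕ} (hv : v ≠ 0) :
    eulerWeight v.primeFactors = v / (Nat.totient v : ℝ) := by
  have h := Nat.totient_eq_mul_prod_factors v
  have h' : (Nat.totient v : ℝ) = v * ∏ p ∈ v.primeFactors, (1 - (p : ℝ)⁻¹) := by
    have h'' := congrArg (Rat.cast : ℚ → ℝ) h
    push_cast at h''
    exact h''
  have hφ : (Nat.totient v : ℝ) ≠ 0 := by
    exact_mod_cast (Nat.totient_pos.2 (Nat.pos_of_ne_zero hv)).ne'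
  rw [eulerWeight, Finset.prod_inv_distrib]
  simp only [one_div]
  rw [h'] at hφ ⊢
  field_simp [right_ne_zero_of_mul hφ, left_ne_zero_of_mul hφ]

theorem moebiusLogSqSum_primeFactors {v : ℕ} (hv : v ≠ 0) (X : ℝ) :
    moebiusLogSqSum v.primeFactors X =
      ∑ n ∈ (Icc 1 ⌊X⌋₊).filter (fun n => Nat.gcd n v = 1),
        ((ArithmeticFunction.moebius n : ℤ) : ℝ) / n * Real.log (X / n) ^ 2 := by
  rw [moebiusLogSqSum]
  congr 1
  refine Finset.filter_congr fun n _ => ?_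
  rw [← Nat.coprime_iff_gcd_eq_one]
  constructor
  · intro h
    refine Nat.coprime_of_dvd fun p hp hpn hpv => ?_
    exact h p (Nat.mem_primeFactors.2 ⟨hp, hpv, hv⟩) hpn
  · intro h p hp hpn
    have hp' := Nat.mem_primeFactors.1 hp
    exact Nat.not_coprime_of_dvd_of_dvd hp'.1.one_lt hpn hp'.2.1 h

/-- Lemma 4.6 (b): for squarefree `v ≤ X^{1/ρ}` and `X` large,
`∑_{n ≤ X, (n,v)=1} (μ(n)/n) log²(X/n)
  = (2v/φ(v))(log X − γ − ∑_{p|v} log p/(p−1) + O*(0.5/log X))`. -/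
theorem statement18 (ρ : ℝ) (hρ0 : 0 < ρ) (hρ1 : ρ < 1 / 8) :
    ∃ X₀ : ℝ, ∀ X : ℝ, X₀ ≤ X → ∀ v : ℕ, Squarefree v → (v : ℝ) ≤ X ^ (1 / ρ) →
      |(∑ n ∈ (Finset.Icc 1 ⌊X⌋₊).filter (fun n => Nat.gcd n v = 1),
          ((ArithmeticFunction.moebius n : ℤ) : ℝ) / n * Real.log (X / n) ^ 2) -
        2 * v / (Nat.totient v : ℝ) *
          (Real.log X - Real.eulerMascheroniConstant -
            ∑ p ∈ v.primeFactors, Real.log p / ((p : ℝ) - 1))| ≤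
      2 * v / (Nat.totient v : ℝ) * (0.5 / Real.log X) := by
  obtain ⟨C, X₁, hC, hX₁, hbase⟩ := exists_forall_abs_moebiusLogSqSum_empty_sub_main_le
  obtain ⟨C', hC', hprod⟩ := exists_forall_prod_one_sub_rpow_inv_le (ε := ρ / 8) (by positivity)
  have hdecay : ∀ᶠ X : ℝ in Filter.atTop, ‖Real.log X‖ ≤ 1 / (2 * C * C') * ‖X ^ (1 / 8 : ℝ)‖ :=
    (isLittleO_log_rpow_atTop (by norm_num)).def (by positivity)
  obtain ⟨X₂, hX₂⟩ := Filter.eventually_atTop.1 hdecay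
  refine ⟨max X₁ X₂, fun X hX v hv hvX => ?_⟩
  have hv0 : v ≠ 0 := hv.ne_zero
  have hX1 : 1 < X := hX₁.trans_le ((le_max_left _ _).trans hX)
  have hX0 : 0 < X := by linarith
  have hlog : 0 < Real.log X := Real.log_pos hX1
  have hP : ∀ q ∈ v.primeFactors, q.Prime := fun q hq => Nat.prime_of_mem_primeFactors hq
  have hbound := abs_moebiusLogSqSum_sub_main_le hP (hbase X ((le_max_left _ _).trans hX)) hX0
  rw [moebiusLogSqSum_primeFactors hv0, moebiusLogSqMain] at hbound
  have hW : 2 * eulerWeight v.primeFactors = 2 * v / (Nat.totient v : ℝ) := by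
    rw [eulerWeight_primeFactors hv0, mul_div_assoc]
  rw [hW] at hbound
  refine hbound.trans ?_
  rw [← hW]
  have hW1 : 1 ≤ eulerWeight v.primeFactors := one_le_eulerWeight hP
  have hpr : ∏ p ∈ v.primeFactors, (1 - (p : ℝ) ^ (-(1 / 2) : ℝ))⁻¹ ≤ C' * X ^ (1 / 8 : ℝ) := by
    refine (hprod v hv0).trans ?_
    gcongr
    calc (v : ℝ) ^ (ρ / 8) ≤ (X ^ (1 / ρ)) ^ (ρ / 8) :=
          Real.rpow_le_rpow (by positivity) hvX (by positivity)
      _ = X ^ (1 / 8 : ℝ) := by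
          rw [← Real.rpow_mul hX0.le]
          congr 1
          field_simp
  have hd := hX₂ X ((le_max_right _ _).trans hX)
  rw [Real.norm_of_nonneg hlog.le, Real.norm_of_nonneg (by positivity)] at hd
  have hfin : C * X ^ (1 / 4 : ℝ) * (C' * X ^ (1 / 8 : ℝ)) * X ^ (-(1 / 2) : ℝ) ≤
      1 / (2 * Real.log X) := by
    have e : X ^ (1 / 4 : ℝ) * X ^ (1 / 8 : ℝ) * X ^ (-(1 / 2) : ℝ) = (X ^ (1 / 8 : ℝ))⁻¹ := by
      rw [← Real.rpow_add hX0, ← Real.rpow_add hX0, ← Real.rpow_neg hX0.le]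
      norm_num
    have hx8 : 0 < X ^ (1 / 8 : ℝ) := by positivity
    calc C * X ^ (1 / 4 : ℝ) * (C' * X ^ (1 / 8 : ℝ)) * X ^ (-(1 / 2) : ℝ)
        = C * C' * (X ^ (1 / 8 : ℝ))⁻¹ := by rw [← e]; ring
      _ ≤ _ := by
        rw [le_div_iff₀ (by positivity)]
        rw [div_mul_eq_mul_div, one_mul, le_div_iff₀ (by positivity)] at hd
        field_simp
        linarith
  calc 1 / (2 * Real.log X) * eulerWeight v.primeFactors +
        C * X ^ (1 / 4 : ℝ) * (∏ p ∈ v.primeFactors, (1 - (p : ℝ) ^ (-(1 / 2) : ℝ))⁻¹) *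
          X ^ (-(1 / 2) : ℝ)
      ≤ 1 / (2 * Real.log X) * eulerWeight v.primeFactors +
        C * X ^ (1 / 4 : ℝ) * (C' * X ^ (1 / 8 : ℝ)) * X ^ (-(1 / 2) : ℝ) := by gcongr
    _ ≤ 1 / (2 * Real.log X) * eulerWeight v.primeFactors +
        1 / (2 * Real.log X) * eulerWeight v.primeFactors := by
      refine add_le_add_right ?_ _
      exact hfin.trans (le_mul_of_one_le_right (by positivity) hW1)
    _ = 2 * eulerWeight v.primeFactors * (0.5 / Real.log X) := by
      ring
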